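/- For every integer n ≥ 2, every integer k ≥ 2 and every exponent 1 < p ≤ 2 there exists ε > 0 with the following property: if u : P₄ → ℝ^k is a smooth solution of the harmonic map heat flow into the unit sphere S^{k−1} on P₄ ⊂ ℝⁿ × ℝ satisfying sup { r^{p−(n+2)} ∫_{P_r(x,t)} (|∇u|^p + r^p |∂_t u|^p) : (x,t) ∈ P₂, 0 < r ≤ 2 } ≤ ε^p, then for every integer m ≥ 1 there is a constant C, depending only on n, k, p, ε, m, such that sup_{P_{1/2}} |∇^m u| ≤ C. -/

import Mathlib

open MeasureTheory Metric Set Filter Real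

noncomputable section

abbrev Sp (n : ℕ) := EuclideanSpace ℝ (Fin n)

/-- The `α`-th spatial coordinate direction in spacetime `ℝⁿ × ℝ`. -/
def sdir (n : ℕ) (α : Fin n) : Sp n × ℝ := (EuclideanSpace.single α 1, 0)

/-- The time direction in spacetime `ℝⁿ × ℝ`. -/
def tdir (n : ℕ) : Sp n × ℝ := (0, 1)

/-- Directional derivative of the `i`-th component of `u` in direction `v`. -/
def pd {n k : ℕ} (u : Sp n × ℝ → Fin k → ℝ) (i : Fin k) (v : Sp n × ℝ) (z : Sp n × ℝ) : ℝ :=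
  fderiv ℝ (fun w => u w i) z v

/-- Squared spatial gradient `|∇u|²`. -/
def gradSq {n k : ℕ} (u : Sp n × ℝ → Fin k → ℝ) (z : Sp n × ℝ) : ℝ :=
  ∑ α : Fin n, ∑ i : Fin k, (pd u i (sdir n α) z) ^ 2

/-- Squared time derivative `|∂ₜu|²`. -/
def dtSq {n k : ℕ} (u : Sp n × ℝ → Fin k → ℝ) (z : Sp n × ℝ) : ℝ :=
  ∑ i : Fin k, (pd u i (tdir n) z) ^ 2

/-- Spatial Laplacian `Δuⁱ`. -/
def lap {n k : ℕ} (u : Sp n × ℝ → Fin k → ℝ) (i : Fin k) (z : Sp n × ℝ) : ℝ :=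
  ∑ α : Fin n, fderiv ℝ (pd u i (sdir n α)) z (sdir n α)

/-- `u` takes values in the unit sphere `S^{k-1}` on `D`. -/
def SphereValued {n k : ℕ} (u : Sp n × ℝ → Fin k → ℝ) (D : Set (Sp n × ℝ)) : Prop :=
  ∀ z ∈ D, ∑ i : Fin k, (u z i) ^ 2 = 1

/-- `u` solves the harmonic map heat flow `∂ₜu = Δu + |∇u|² u` into the sphere on `D`. -/
def HeatFlow {n k : ℕ} (u : Sp n × ℝ → Fin k → ℝ) (D : Set (Sp n × ℝ)) : Prop :=
  ∀ z ∈ D, ∀ i : Fin k, pd u i (tdir n) z = lap u i z + gradSq u z * u z i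

/-- Parabolic cylinder `P_r(z₀) = closedBall(x₀,r) × (t₀ - r², t₀]`. -/
def pcyl {n : ℕ} (z₀ : Sp n × ℝ) (r : ℝ) : Set (Sp n × ℝ) :=
  closedBall z₀.1 r ×ˢ Ioc (z₀.2 - r ^ 2) z₀.2

open Topology ContDiff

/-! ### One-variable derivative tests -/

lemma HasDerivAt.nonneg_of_eventually_right {f : ℝ → ℝ} {a c : ℝ} (hf : HasDerivAt f c a)
    (h : ∀ᶠ s in 𝓝[>] a, f a ≤ f s) : 0 ≤ c := by
  have hs := (hasDerivAt_iff_tendsto_slope.1 hf).mono_left (nhdsGT_le_nhdsNE a)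
  refine ge_of_tendsto hs ?_
  filter_upwards [h, self_mem_nhdsWithin] with s h1 h2
  have : 0 < s - a := sub_pos.2 h2
  rw [slope_def_field]
  exact div_nonneg (by linarith) this.le

lemma HasDerivAt.nonneg_of_eventually_left {f : ℝ → ℝ} {a c : ℝ} (hf : HasDerivAt f c a)
    (h : ∀ᶠ s in 𝓝[<] a, f s ≤ f a) : 0 ≤ c := by
  have hs := (hasDerivAt_iff_tendsto_slope.1 hf).mono_left (nhdsLT_le_nhdsNE a)
  refine ge_of_tendsto hs ?_
  filter_upwards [h, self_mem_nhdsWithin] with s h1 h2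
  have : s - a < 0 := sub_neg.2 h2
  rw [slope_def_field]
  exact div_nonneg_of_nonpos (by linarith) this.le

/-- Second derivative test: at a local maximum the second derivative is nonpositive. -/
lemma IsLocalMax.second_deriv_nonpos {g g' : ℝ → ℝ} {c : ℝ}
    (hg : ∀ᶠ s in 𝓝 0, HasDerivAt g (g' s) s) (hg' : HasDerivAt g' c 0)
    (hmax : IsLocalMax g 0) : c ≤ 0 := by
  by_contra! hc
  have hd : deriv g =ᶠ[𝓝 0] g' := hg.mono fun s hs => hs.deriv
  have h0 : deriv g 0 = 0 := hmax.deriv_eq_zero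
  have h2 : deriv (deriv g) 0 = c := by rw [hd.deriv_eq, hg'.deriv]
  have hmin := isLocalMin_of_deriv_deriv_pos (by rw [h2]; exact hc) h0 hg.self_of_nhds.continuousAt
  have hconst : g =ᶠ[𝓝 0] fun _ => g 0 := by
    filter_upwards [hmax, hmin] with s h1 h2 using le_antisymm h1 h2
  have : deriv g =ᶠ[𝓝 0] fun _ => 0 := by
    filter_upwards [hconst.eventuallyEq_nhds] with s hs
    rw [hs.deriv_eq, deriv_const]
  rw [this.deriv_eq, deriv_const] at h2
  exact hc.ne h2

/-! ### Space-time derivatives and closed parabolic cylinders -/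

section Calculus

variable {n : ℕ} {E : Type*} [NormedAddCommGroup E] [NormedSpace ℝ E]

/-- The spatial derivative of a map on space-time. -/
def spD (v : Sp n × ℝ → E) (z : Sp n × ℝ) : Sp n →L[ℝ] E :=
  (fderiv ℝ v z).comp (ContinuousLinearMap.inl ℝ (Sp n) ℝ)

/-- The spatial Laplacian of a vector-valued map on space-time. -/
def spLap (v : Sp n × ℝ → E) (z : Sp n × ℝ) : E :=
  ∑ α : Fin n, fderiv ℝ (fun w => fderiv ℝ v w (sdir n α)) z (sdir n α)

/-- The heat operator `∂ₜ - Δ`. -/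
def heatOp (v : Sp n × ℝ → E) (z : Sp n × ℝ) : E :=
  fderiv ℝ v z (tdir n) - spLap v z

/-- The closed parabolic cylinder. -/
def cpcyl (z₀ : Sp n × ℝ) (r : ℝ) : Set (Sp n × ℝ) :=
  closedBall z₀.1 r ×ˢ Icc (z₀.2 - r ^ 2) z₀.2

lemma mem_cpcyl {z₀ z : Sp n × ℝ} {r : ℝ} :
    z ∈ cpcyl z₀ r ↔ ‖z.1 - z₀.1‖ ≤ r ∧ z₀.2 - r ^ 2 ≤ z.2 ∧ z.2 ≤ z₀.2 := by
  simp [cpcyl, mem_prod, dist_eq_norm]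

lemma isCompact_cpcyl (z₀ : Sp n × ℝ) (r : ℝ) : IsCompact (cpcyl z₀ r) :=
  (isCompact_closedBall _ _).prod isCompact_Icc

lemma self_mem_cpcyl (z₀ : Sp n × ℝ) {r : ℝ} (hr : 0 ≤ r) : z₀ ∈ cpcyl z₀ r := by
  rw [mem_cpcyl]; simp [hr]

lemma hasDerivAt_line {w : Sp n × ℝ → ℝ} {z e : Sp n × ℝ} {s : ℝ}
    (hw : DifferentiableAt ℝ w (z + s • e)) :
    HasDerivAt (fun s : ℝ => w (z + s • e)) (fderiv ℝ w (z + s • e) e) s := by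
  have h1 : HasDerivAt (fun s : ℝ => z + s • e) e s := by
    simpa using ((hasDerivAt_id s).smul_const e).const_add z
  exact hw.hasFDerivAt.comp_hasDerivAt s h1

/-- Reflection of space-time in the hyperplane through `a` orthogonal to the `α`-th axis. -/
def reflAt (α : Fin n) (a : ℝ) (z : Sp n × ℝ) : Sp n × ℝ :=
  z + (2 * (a - z.1 α)) • sdir n α

lemma norm_add_smul_single_sq (x : Sp n) (s : ℝ) (β : Fin n) :
    ‖x + s • EuclideanSpace.single β (1 : ℝ)‖ ^ 2 = ‖x‖ ^ 2 + 2 * s * x β + s ^ 2 := by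
  rw [norm_add_sq_real, inner_smul_right, EuclideanSpace.inner_single_right, norm_smul]
  simp
  ring

lemma reflAt_norm (α : Fin n) (z₀ z : Sp n × ℝ) :
    ‖(reflAt α (z₀.1 α) z).1 - z₀.1‖ = ‖z.1 - z₀.1‖ := by
  rw [← sq_eq_sq₀ (norm_nonneg _) (norm_nonneg _)]
  have : (reflAt α (z₀.1 α) z).1 - z₀.1 = (z.1 - z₀.1) +
      (2 * (z₀.1 α - z.1 α)) • EuclideanSpace.single α (1 : ℝ) := by
    simp [reflAt, sdir]; abel
  rw [this, norm_add_smul_single_sq]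
  simp
  ring

lemma reflAt_mem_cpcyl {α : Fin n} {z₀ z : Sp n × ℝ} {r : ℝ} (hz : z ∈ cpcyl z₀ r) :
    reflAt α (z₀.1 α) z ∈ cpcyl z₀ r := by
  rw [mem_cpcyl] at hz ⊢
  rw [reflAt_norm]
  simpa [reflAt, sdir] using hz

end Calculus

section Barrier

variable {n : ℕ}

lemma reflAt_add_smul_of_ne {α β : Fin n} (h : β ≠ α) (a s : ℝ) (z : Sp n × ℝ) :
    reflAt α a (z + s • sdir n β) = reflAt α a z + s • sdir n β := by
  have : (sdir n β).1 α = 0 := by simp [sdir, h.symm]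
  simp only [reflAt, Prod.fst_add, Prod.smul_fst, PiLp.add_apply, PiLp.smul_apply, this]
  simp
  abel

lemma reflAt_add_smul_self {α : Fin n} (a s : ℝ) (z : Sp n × ℝ) :
    reflAt α a (z + s • sdir n α) = reflAt α a z + s • (-sdir n α) := by
  have : (sdir n α).1 α = 1 := by simp [sdir]
  simp only [reflAt, Prod.fst_add, Prod.smul_fst, PiLp.add_apply, PiLp.smul_apply, this]
  simp only [smul_eq_mul]
  module

lemma reflAt_add_smul_tdir {α : Fin n} (a s : ℝ) (z : Sp n × ℝ) :
    reflAt α a (z + s • tdir n) = reflAt α a z + s • tdir n := by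
  simp only [reflAt, Prod.fst_add, Prod.smul_fst, PiLp.add_apply, PiLp.smul_apply, tdir]
  simp
  abel

/-- The comparison function for the interior gradient estimate. -/
def barrier (α : Fin n) (z₀ : Sp n × ℝ) (d c κ : ℝ) (z : Sp n × ℝ) : ℝ :=
  c * (‖z.1 - z₀.1‖ ^ 2 - (z.2 - z₀.2)) + κ * ((z.1 α - z₀.1 α) * (d - (z.1 α - z₀.1 α)))

lemma barrier_add_smul_sdir (α β : Fin n) (z₀ : Sp n × ℝ) (d c κ : ℝ) (z : Sp n × ℝ) :
    ∃ b₀ b₁ : ℝ, ∀ s : ℝ, barrier α z₀ d c κ (z + s • sdir n β) =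
      b₀ + b₁ * s + (c - if α = β then κ else 0) * s ^ 2 := by
  refine ⟨barrier α z₀ d c κ z, 2 * c * (z.1 - z₀.1) β +
    (if α = β then κ * (d - 2 * (z.1 α - z₀.1 α)) else 0), fun s => ?_⟩
  have h1 : (z + s • sdir n β).1 - z₀.1 =
      (z.1 - z₀.1) + s • EuclideanSpace.single β (1 : ℝ) := by
    simp [sdir]; abel
  have h2 : (z + s • sdir n β).2 = z.2 := by simp [sdir]
  have h3 : (z + s • sdir n β).1 α = z.1 α + if α = β then s else 0 := by
    simp [sdir]
  rw [barrier, barrier, h1, h2, h3, norm_add_smul_single_sq]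
  split_ifs <;> ring

lemma hasDerivAt_quadratic (b₀ b₁ b₂ s : ℝ) :
    HasDerivAt (fun s : ℝ => b₀ + b₁ * s + b₂ * s ^ 2) (b₁ + 2 * b₂ * s) s := by
  have := (((hasDerivAt_id s).const_mul b₁).const_add b₀).add
    (((hasDerivAt_id s).pow 2).const_mul b₂)
  refine (this.congr_deriv ?_).congr_of_eventuallyEq ?_
  · simp; ring
  · filter_upwards with s using by simp

lemma ContDiffOn.differentiableAt_fderiv_apply {U : Set (Sp n × ℝ)} (hU : IsOpen U)
    {E : Type*} [NormedAddCommGroup E] [NormedSpace ℝ E] {w : Sp n × ℝ → E}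
    (hw : ContDiffOn ℝ ∞ w U) {z : Sp n × ℝ} (hz : z ∈ U) (e : Sp n × ℝ) :
    DifferentiableAt ℝ (fun y => fderiv ℝ w y e) z := by
  have h := (hw.fderiv_of_isOpen hU (m := 1) (by norm_cast)).differentiableOn one_ne_zero
  exact ((h.differentiableAt (hU.mem_nhds hz))).clm_apply (differentiableAt_const e)

lemma second_deriv_nonpos_of_line_max {U : Set (Sp n × ℝ)} (hU : IsOpen U) {w : Sp n × ℝ → ℝ}
    (hw : ContDiffOn ℝ ∞ w U) {z z' e e' : Sp n × ℝ} (hz : z ∈ U) (hz' : z' ∈ U)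
    {b₀ b₁ b₂ : ℝ}
    (hmax : IsLocalMax (fun s : ℝ => w (z + s • e) - w (z' + s • e') -
      2 * (b₀ + b₁ * s + b₂ * s ^ 2)) 0) :
    fderiv ℝ (fun y => fderiv ℝ w y e) z e - fderiv ℝ (fun y => fderiv ℝ w y e') z' e'
      ≤ 4 * b₂ := by
  have hline : ∀ (z e : Sp n × ℝ), z ∈ U → ∀ᶠ s : ℝ in 𝓝 0, z + s • e ∈ U := by
    intro z e hz
    have hc : Continuous fun s : ℝ => z + s • e := by fun_prop
    exact hc.continuousAt.eventually_mem (hU.mem_nhds (by simpa using hz))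
  have hdiff : ∀ y ∈ U, DifferentiableAt ℝ w y := fun y hy =>
    (hw.differentiableOn (by simp)).differentiableAt (hU.mem_nhds hy)
  have hd : ∀ z e : Sp n × ℝ, z ∈ U → HasDerivAt (fun s : ℝ => fderiv ℝ w (z + s • e) e)
      (fderiv ℝ (fun y => fderiv ℝ w y e) z e) 0 := by
    intro z e hz
    have := hasDerivAt_line (w := fun y => fderiv ℝ w y e) (z := z) (e := e) (s := 0)
      (hw.differentiableAt_fderiv_apply hU (by simpa using hz) e)
    simpa using this
  have key := IsLocalMax.second_deriv_nonpos
    (g' := fun s => fderiv ℝ w (z + s • e) e - fderiv ℝ w (z' + s • e') e' -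
      2 * (b₁ + 2 * b₂ * s))
    (c := fderiv ℝ (fun y => fderiv ℝ w y e) z e - fderiv ℝ (fun y => fderiv ℝ w y e') z' e' -
      2 * (2 * b₂)) ?_ ?_ hmax
  · linarith
  · filter_upwards [hline z e hz, hline z' e' hz'] with s h1 h2
    exact ((hasDerivAt_line (hdiff _ h1)).sub (hasDerivAt_line (hdiff _ h2))).sub
      ((hasDerivAt_quadratic b₀ b₁ b₂ s).const_mul 2)
  · refine ((hd z e hz).sub (hd z' e' hz')).sub (HasDerivAt.const_mul 2 ?_)
    simpa using ((hasDerivAt_id (0 : ℝ)).const_mul (2 * b₂)).const_add b₁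

/-- Interior gradient estimate for the heat equation, one component: the odd part of `w` under a
reflection is compared with an explicit barrier on half a cylinder. -/
theorem fderiv_sdir_le_of_heatOp_bound {U : Set (Sp n × ℝ)} (hU : IsOpen U) {w : Sp n × ℝ → ℝ}
    (hw : ContDiffOn ℝ ∞ w U) {z₀ : Sp n × ℝ} {d M F : ℝ} (hd : 0 < d) (hM : 0 < M)
    (hsub : cpcyl z₀ d ⊆ U) (hwM : ∀ z ∈ cpcyl z₀ d, |w z| ≤ M)
    (hwF : ∀ z ∈ cpcyl z₀ d, |heatOp w z| ≤ F) (α : Fin n) :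
    fderiv ℝ w z₀ (sdir n α) ≤ (n + 1) * M / d + F * d / 2 := by
  have hF : 0 ≤ F := (abs_nonneg _).trans (hwF z₀ (self_mem_cpcyl z₀ hd.le))
  set c : ℝ := M / d ^ 2 with hc
  have hcpos : 0 < c := by positivity
  have hcd : c * d ^ 2 = M := by rw [hc]; field_simp
  set κ : ℝ := F / 2 + (n + 1) * c with hκ
  have hκpos : 0 ≤ κ := by positivity
  set Φ : Sp n × ℝ → ℝ := fun z => w z - w (reflAt α (z₀.1 α) z) - 2 * barrier α z₀ d c κ z
    with hΦ
  set H : Set (Sp n × ℝ) := cpcyl z₀ d ∩ {z | z₀.1 α ≤ z.1 α} with hH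
  have hcontR : Continuous (reflAt α (z₀.1 α) : Sp n × ℝ → Sp n × ℝ) := by
    unfold reflAt; fun_prop
  have hcoord : ∀ z ∈ H, z.1 α - z₀.1 α ≤ d := by
    intro z hz
    have h1 := (mem_cpcyl.1 hz.1).1
    have h2 := PiLp.norm_apply_le (z.1 - z₀.1) α
    exact (le_abs_self _).trans (by simpa using h2.trans h1)
  have hΦle : ∀ z ∈ H, Φ z ≤ 0 := by
    have hHc : IsCompact H :=
      (isCompact_cpcyl z₀ d).inter_right (isClosed_le (by fun_prop) (by fun_prop))
    have hΦc : ContinuousOn Φ H := by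
      have h1 : ContinuousOn w H := hw.continuousOn.mono (inter_subset_left.trans hsub)
      have h2 : ContinuousOn (fun z => w (reflAt α (z₀.1 α) z)) H :=
        hw.continuousOn.comp hcontR.continuousOn fun z hz => hsub (reflAt_mem_cpcyl hz.1)
      have h3 : Continuous (barrier α z₀ d c κ) := by unfold barrier; fun_prop
      exact (h1.sub h2).sub (continuousOn_const.mul h3.continuousOn)
    by_contra! hcon
    obtain ⟨z', hz', hpos'⟩ := hcon
    obtain ⟨z, hz, hmax⟩ := hHc.exists_isMaxOn ⟨z', hz'⟩ hΦc
    have hpos : 0 < Φ z := hpos'.trans_le (hmax hz')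
    have hRz := reflAt_mem_cpcyl (α := α) hz.1
    obtain ⟨hz1, hz2, hz3⟩ := mem_cpcyl.1 hz.1
    have hσ : 0 ≤ z.1 α - z₀.1 α := sub_nonneg.2 hz.2
    have hσd := hcoord z hz
    have hw2 : w z - w (reflAt α (z₀.1 α) z) ≤ 2 * M := by
      linarith [abs_le.1 (hwM z hz.1), abs_le.1 (hwM _ hRz)]
    have hκσ : 0 ≤ κ * ((z.1 α - z₀.1 α) * (d - (z.1 α - z₀.1 α))) :=
      mul_nonneg hκpos (mul_nonneg hσ (by linarith))
    have hΦz : Φ z = w z - w (reflAt α (z₀.1 α) z) - 2 * (c * (‖z.1 - z₀.1‖ ^ 2 - (z.2 - z₀.2))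
      + κ * ((z.1 α - z₀.1 α) * (d - (z.1 α - z₀.1 α)))) := rfl
    have hσpos : z₀.1 α < z.1 α := by
      refine lt_of_le_of_ne hz.2 fun h => ?_
      have hR : reflAt α (z₀.1 α) z = z := by simp [reflAt, h]
      rw [hR] at hΦz
      have : 0 ≤ c * (‖z.1 - z₀.1‖ ^ 2 - (z.2 - z₀.2)) :=
        mul_nonneg hcpos.le (by nlinarith [sq_nonneg ‖z.1 - z₀.1‖])
      linarith
    have hlt1 : ‖z.1 - z₀.1‖ < d := by
      refine lt_of_le_of_ne hz1 fun h => ?_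
      rw [h] at hΦz
      have : c * d ^ 2 ≤ c * (d ^ 2 - (z.2 - z₀.2)) :=
        mul_le_mul_of_nonneg_left (by linarith) hcpos.le
      linarith
    have hlt2 : z₀.2 - d ^ 2 < z.2 := by
      refine lt_of_le_of_ne hz2 fun h => ?_
      have : c * d ^ 2 ≤ c * (‖z.1 - z₀.1‖ ^ 2 - (z.2 - z₀.2)) :=
        mul_le_mul_of_nonneg_left (by nlinarith [sq_nonneg ‖z.1 - z₀.1‖]) hcpos.le
      linarith
    have hzU := hsub hz.1
    have hRU := hsub hRz
    have hspace : ∀ e : Sp n × ℝ, e.2 = 0 → ∀ᶠ s : ℝ in 𝓝 0, z + s • e ∈ H := by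
      intro e he
      have hcl : Continuous fun s : ℝ => z + s • e := by fun_prop
      have hc1 : ∀ᶠ s : ℝ in 𝓝 0, ‖(z + s • e).1 - z₀.1‖ < d :=
        (Continuous.continuousAt (by fun_prop)).eventually_lt_const (by simpa using hlt1)
      have hc2 : ∀ᶠ s : ℝ in 𝓝 0, z₀.1 α < (z + s • e).1 α :=
        (Continuous.continuousAt (by fun_prop)).eventually_const_lt (by simpa using hσpos)
      filter_upwards [hc1, hc2] with s h1 h2
      refine ⟨mem_cpcyl.2 ⟨h1.le, ?_⟩, h2.le⟩
      have h3 : (z + s • e).2 = z.2 := by simp [he]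
      rw [h3]
      exact ⟨hz2, hz3⟩
    have hlap : ∀ β : Fin n, fderiv ℝ (fun y => fderiv ℝ w y (sdir n β)) z (sdir n β) -
        fderiv ℝ (fun y => fderiv ℝ w y (sdir n β)) (reflAt α (z₀.1 α) z) (sdir n β) ≤
        4 * (c - if α = β then κ else 0) := by
      intro β
      obtain ⟨b₀, b₁, hb⟩ := barrier_add_smul_sdir α β z₀ d c κ z
      have hm : IsLocalMax (fun s : ℝ => Φ (z + s • sdir n β)) 0 := by
        filter_upwards [hspace (sdir n β) rfl] with s hs
        simpa using hmax hs
      simp only [hΦ, hb] at hm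
      by_cases hβ : β = α
      · subst hβ
        simp only [reflAt_add_smul_self] at hm
        have := second_deriv_nonpos_of_line_max hU hw hzU hRU hm
        have hneg : (fun y => fderiv ℝ w y (-sdir n β)) =
            -fun y => fderiv ℝ w y (sdir n β) := by
          ext y; simp
        rw [hneg, fderiv_neg] at this
        simpa using this
      · simp only [reflAt_add_smul_of_ne hβ] at hm
        exact second_deriv_nonpos_of_line_max hU hw hzU hRU hm
    have hsum : spLap w z - spLap w (reflAt α (z₀.1 α) z) ≤ 4 * (n * c - κ) := by
      rw [spLap, spLap, ← Finset.sum_sub_distrib]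
      refine (Finset.sum_le_sum fun β _ => hlap β).trans (le_of_eq ?_)
      rw [← Finset.mul_sum, Finset.sum_sub_distrib]
      simp
    have htime : 0 ≤ fderiv ℝ w z (tdir n) - fderiv ℝ w (reflAt α (z₀.1 α) z) (tdir n) + 2 * c := by
      have hdiff : ∀ y ∈ U, DifferentiableAt ℝ w y := fun y hy =>
        (hw.differentiableOn (by simp)).differentiableAt (hU.mem_nhds hy)
      have h1 : HasDerivAt (fun s : ℝ => w (z + s • tdir n)) (fderiv ℝ w z (tdir n)) 0 := by
        simpa using hasDerivAt_line (w := w) (z := z) (e := tdir n) (s := 0)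
          (hdiff _ (by simpa using hzU))
      have h2 : HasDerivAt (fun s : ℝ => w (reflAt α (z₀.1 α) z + s • tdir n))
          (fderiv ℝ w (reflAt α (z₀.1 α) z) (tdir n)) 0 := by
        simpa using hasDerivAt_line (w := w) (z := reflAt α (z₀.1 α) z) (e := tdir n) (s := 0)
          (hdiff _ (by simpa using hRU))
      have h3 : HasDerivAt (fun s : ℝ => barrier α z₀ d c κ (z + s • tdir n)) (-c) 0 := by
        have heq : (fun s : ℝ => barrier α z₀ d c κ (z + s • tdir n)) =
            fun s => barrier α z₀ d c κ z + -c * s + 0 * s ^ 2 := by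
          ext s; simp [barrier, tdir]; ring
        rw [heq]
        simpa using hasDerivAt_quadratic (barrier α z₀ d c κ z) (-c) 0 0
      have h4 := ((h1.sub h2).sub (h3.const_mul 2)).nonneg_of_eventually_left ?_
      · linarith
      · have hc2 : ∀ᶠ s : ℝ in 𝓝[<] 0, z₀.2 - d ^ 2 < (z + s • tdir n).2 :=
          nhdsWithin_le_nhds ((Continuous.continuousAt (by fun_prop)).eventually_const_lt
            (by simpa using hlt2))
        filter_upwards [hc2, self_mem_nhdsWithin] with s hs1 (hs2 : s < 0)
        have hmem : z + s • tdir n ∈ H := by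
          refine ⟨mem_cpcyl.2 ⟨?_, hs1.le, ?_⟩, ?_⟩
          · simpa [tdir] using hz1
          · simp [tdir]; linarith
          · simpa [tdir] using hσpos.le
        have := hmax hmem
        simpa [hΦ, reflAt_add_smul_tdir] using this
    have e1 := (abs_le.1 (hwF z hz.1)).2
    have e2 := (abs_le.1 (hwF _ hRz)).1
    rw [heatOp] at e1 e2
    nlinarith
  have hray : ∀ s ∈ Icc 0 d, z₀ + s • sdir n α ∈ H := by
    intro s hs
    refine ⟨mem_cpcyl.2 ⟨?_, ?_⟩, ?_⟩
    · simpa [sdir, norm_smul, abs_of_nonneg hs.1] using hs.2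
    · simp [sdir, sq_nonneg]
    · simpa [sdir] using hs.1
  have hdiff : DifferentiableAt ℝ w z₀ :=
    (hw.differentiableOn (by simp)).differentiableAt
      (hU.mem_nhds (hsub (self_mem_cpcyl z₀ hd.le)))
  have h1 : ∀ e, HasDerivAt (fun s : ℝ => w (z₀ + s • e)) (fderiv ℝ w z₀ e) 0 := fun e => by
    simpa using hasDerivAt_line (w := w) (z := z₀) (e := e) (s := 0) (by simpa using hdiff)
  have hR0 : reflAt α (z₀.1 α) z₀ = z₀ := by simp [reflAt]
  have h4 := ((hasDerivAt_quadratic 0 (2 * κ * d) (2 * c - 2 * κ) 0).sub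
    ((h1 (sdir n α)).sub (h1 (-sdir n α)))).nonneg_of_eventually_right ?_
  · have : κ * d = (n + 1) * M / d + F * d / 2 := by
      rw [hκ, hc]; field_simp; ring
    simp at h4
    linarith
  · filter_upwards [Ioo_mem_nhdsGT hd] with s hs
    have := hΦle _ (hray s ⟨hs.1.le, hs.2.le⟩)
    simp only [hΦ, reflAt_add_smul_self, hR0] at this
    have hb : barrier α z₀ d c κ (z₀ + s • sdir n α) = c * s ^ 2 + κ * (s * (d - s)) := by
      simp [barrier, sdir, norm_smul]
    rw [hb] at this
    simp
    simp at this
    linarith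

end Barrier

section GradientEstimate

variable {n : ℕ} {E : Type*} [NormedAddCommGroup E] [NormedSpace ℝ E]

lemma ContDiffOn.differentiableAt_of_isOpen {U : Set (Sp n × ℝ)} (hU : IsOpen U)
    {v : Sp n × ℝ → E} (hv : ContDiffOn ℝ ∞ v U) {z : Sp n × ℝ} (hz : z ∈ U) :
    DifferentiableAt ℝ v z :=
  (hv.differentiableOn (by simp)).differentiableAt (hU.mem_nhds hz)

lemma ContDiffOn.fderiv_infty {U : Set (Sp n × ℝ)} (hU : IsOpen U)
    {v : Sp n × ℝ → E} (hv : ContDiffOn ℝ ∞ v U) : ContDiffOn ℝ ∞ (fderiv ℝ v) U :=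
  hv.fderiv_of_isOpen hU (by simp)

lemma ContDiffOn.spD {U : Set (Sp n × ℝ)} (hU : IsOpen U)
    {v : Sp n × ℝ → E} (hv : ContDiffOn ℝ ∞ v U) : ContDiffOn ℝ ∞ (spD v) U :=
  (hv.fderiv_infty hU).clm_comp contDiffOn_const

lemma fderiv_clm_comp_apply {F : Type*} [NormedAddCommGroup F] [NormedSpace ℝ F] (l : E →L[ℝ] F)
    {v : Sp n × ℝ → E} {z : Sp n × ℝ} (hv : DifferentiableAt ℝ v z) (e : Sp n × ℝ) :
    fderiv ℝ (fun y => l (v y)) z e = l (fderiv ℝ v z e) := by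
  have := (l.hasFDerivAt.comp z hv.hasFDerivAt).fderiv
  rw [Function.comp_def] at this
  rw [this]; rfl

lemma fderiv_fderiv_clm_comp_apply {F : Type*} [NormedAddCommGroup F] [NormedSpace ℝ F]
    (l : E →L[ℝ] F) {U : Set (Sp n × ℝ)} (hU : IsOpen U) {v : Sp n × ℝ → E}
    (hv : ContDiffOn ℝ ∞ v U) {z : Sp n × ℝ} (hz : z ∈ U) (e e' : Sp n × ℝ) :
    fderiv ℝ (fun w => fderiv ℝ (fun y => l (v y)) w e) z e' =
      l (fderiv ℝ (fun w => fderiv ℝ v w e) z e') := by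
  rw [← fderiv_clm_comp_apply l (hv.differentiableAt_fderiv_apply hU hz e)]
  have : (fun w => fderiv ℝ (fun y => l (v y)) w e) =ᶠ[𝓝 z] fun w => l (fderiv ℝ v w e) := by
    filter_upwards [hU.mem_nhds hz] with w hw
    exact fderiv_clm_comp_apply l (hv.differentiableAt_of_isOpen hU hw) e
  rw [this.fderiv_eq]

lemma spLap_clm_comp {F : Type*} [NormedAddCommGroup F] [NormedSpace ℝ F]
    (l : E →L[ℝ] F) {U : Set (Sp n × ℝ)} (hU : IsOpen U) {v : Sp n × ℝ → E}
    (hv : ContDiffOn ℝ ∞ v U) {z : Sp n × ℝ} (hz : z ∈ U) :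
    spLap (fun y => l (v y)) z = l (spLap v z) := by
  simp only [spLap, map_sum]
  exact Finset.sum_congr rfl fun α _ => fderiv_fderiv_clm_comp_apply l hU hv hz _ _

lemma heatOp_clm_comp {F : Type*} [NormedAddCommGroup F] [NormedSpace ℝ F]
    (l : E →L[ℝ] F) {U : Set (Sp n × ℝ)} (hU : IsOpen U) {v : Sp n × ℝ → E}
    (hv : ContDiffOn ℝ ∞ v U) {z : Sp n × ℝ} (hz : z ∈ U) :
    heatOp (fun y => l (v y)) z = l (heatOp v z) := by
  rw [heatOp, heatOp, spLap_clm_comp l hU hv hz, map_sub,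
    fderiv_clm_comp_apply l (hv.differentiableAt_of_isOpen hU hz)]

lemma norm_clm_le_of_single (T : Sp n →L[ℝ] E) {K : ℝ} (hK : 0 ≤ K)
    (h : ∀ α, ‖T (EuclideanSpace.single α 1)‖ ≤ K) : ‖T‖ ≤ n * K := by
  refine T.opNorm_le_bound (by positivity) fun x => ?_
  have hx : x = ∑ α, x α • EuclideanSpace.single α (1 : ℝ) := by
    simpa using ((EuclideanSpace.basisFun (Fin n) ℝ).sum_repr x).symm
  have hT : T x = ∑ α, x α • T (EuclideanSpace.single α (1 : ℝ)) := by
    conv_lhs => rw [hx]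
    simp
  rw [hT]
  calc ‖∑ α, x α • T (EuclideanSpace.single α (1 : ℝ))‖
      ≤ ∑ α, ‖x α • T (EuclideanSpace.single α (1 : ℝ))‖ := norm_sum_le _ _
    _ ≤ ∑ _α : Fin n, ‖x‖ * K := by
        refine Finset.sum_le_sum fun α _ => ?_
        rw [norm_smul]
        exact mul_le_mul (PiLp.norm_apply_le x α) (h α) (norm_nonneg _) (norm_nonneg _)
    _ = n * K * ‖x‖ := by simp; ring

/-- Interior gradient estimate for the heat equation with bounded right-hand side. -/
theorem norm_spD_le_of_heatOp_bound {U : Set (Sp n × ℝ)} (hU : IsOpen U) {v : Sp n × ℝ → E}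
    (hv : ContDiffOn ℝ ∞ v U) {z₀ : Sp n × ℝ} {d M F : ℝ} (hd : 0 < d) (hM : 0 < M)
    (hsub : cpcyl z₀ d ⊆ U) (hvM : ∀ z ∈ cpcyl z₀ d, ‖v z‖ ≤ M)
    (hvF : ∀ z ∈ cpcyl z₀ d, ‖heatOp v z‖ ≤ F) :
    ‖spD v z₀‖ ≤ n * ((n + 1) * M / d + F * d / 2) := by
  have hF : 0 ≤ F := (norm_nonneg _).trans (hvF z₀ (self_mem_cpcyl z₀ hd.le))
  refine norm_clm_le_of_single _ (by positivity) fun α => ?_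
  obtain ⟨l, hl, hlx⟩ := exists_dual_vector'' ℝ (spD v z₀ (EuclideanSpace.single α 1))
  have hlb : ∀ x : E, |l x| ≤ ‖x‖ := fun x => by
    simpa using l.le_of_opNorm_le hl x
  have hz₀ := hsub (self_mem_cpcyl z₀ hd.le)
  have := fderiv_sdir_le_of_heatOp_bound hU (w := fun y => l (v y))
    (l.contDiff.comp_contDiffOn hv) hd hM hsub
    (fun z hz => (hlb _).trans (hvM z hz))
    (fun z hz => by
      rw [heatOp_clm_comp l hU hv (hsub hz)]
      exact (hlb _).trans (hvF z hz)) α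
  rw [fderiv_clm_comp_apply l (hv.differentiableAt_of_isOpen hU hz₀)] at this
  have h2 : l (fderiv ℝ v z₀ (sdir n α)) = ‖spD v z₀ (EuclideanSpace.single α 1)‖ := by
    simpa [spD, sdir] using hlx
  linarith

/-- Parabolic point picking. -/
lemma exists_point_picking {f : Sp n × ℝ → ℝ} {z₀ : Sp n × ℝ} {r : ℝ} (hr : 0 < r)
    (hf : ContinuousOn f (cpcyl z₀ r)) (hf0 : 0 < f z₀) :
    ∃ z ρ, 0 < ρ ∧ ρ ≤ r ∧ cpcyl z ρ ⊆ cpcyl z₀ r ∧ r * f z₀ ≤ ρ * f z ∧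
      ∀ y ∈ cpcyl z (ρ / 2), f y ≤ 2 * f z := by
  set K : Set ((Sp n × ℝ) × ℝ) := (cpcyl z₀ r ×ˢ Icc 0 r) ∩
    ({q | ‖q.1.1 - z₀.1‖ + q.2 ≤ r} ∩ {q | z₀.2 - r ^ 2 + q.2 ^ 2 ≤ q.1.2}) with hK
  have hKc : IsCompact K := ((isCompact_cpcyl z₀ r).prod isCompact_Icc).inter_right
    ((isClosed_le (by fun_prop) (by fun_prop)).inter (isClosed_le (by fun_prop) (by fun_prop)))
  have h0 : (z₀, r) ∈ K := by
    refine ⟨⟨self_mem_cpcyl z₀ hr.le, hr.le, le_rfl⟩, ?_, ?_⟩ <;> simp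
  have hc : ContinuousOn (fun q : (Sp n × ℝ) × ℝ => q.2 * f q.1) K :=
    continuousOn_snd.mul (hf.comp continuousOn_fst fun q hq => hq.1.1)
  obtain ⟨⟨z, ρ⟩, hz, hmax⟩ := hKc.exists_isMaxOn ⟨_, h0⟩ hc
  have hle : r * f z₀ ≤ ρ * f z := hmax h0
  obtain ⟨⟨hz1, hρ0, hρr⟩, hzρ, hzt⟩ := hz
  simp only [mem_ofPred_eq] at hzρ hzt hρ0 hρr
  have hρ : 0 < ρ := by
    refine lt_of_le_of_ne hρ0 fun h => ?_
    rw [← h] at hle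
    nlinarith
  obtain ⟨-, -, hzt0⟩ := mem_cpcyl.1 hz1
  have hsub : cpcyl z ρ ⊆ cpcyl z₀ r := by
    intro y hy
    obtain ⟨h1, h2, h3⟩ := mem_cpcyl.1 hy
    refine mem_cpcyl.2 ⟨?_, by linarith, h3.trans hzt0⟩
    have := norm_sub_le_norm_sub_add_norm_sub y.1 z.1 z₀.1
    linarith
  refine ⟨z, ρ, hρ, hρr, hsub, hle, fun y hy => ?_⟩
  obtain ⟨h1, h2, h3⟩ := mem_cpcyl.1 hy
  have hyz : y ∈ cpcyl z ρ := mem_cpcyl.2 ⟨by linarith, by nlinarith, h3⟩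
  have hyK : (y, ρ / 2) ∈ K := by
    refine ⟨⟨hsub hyz, by simp; linarith, by simp; linarith⟩, ?_, ?_⟩
    · have := norm_sub_le_norm_sub_add_norm_sub y.1 z.1 z₀.1
      simp only [mem_ofPred_eq]
      linarith
    · simp only [mem_ofPred_eq]
      nlinarith
  have h4 : ρ / 2 * f y ≤ ρ * f z := hmax hyK
  have h5 : ρ * f y ≤ ρ * (2 * f z) := by linarith
  exact le_of_mul_le_mul_left h5 hρ

lemma cpcyl_subset_cpcyl (z : Sp n × ℝ) {r s : ℝ} (hr : 0 ≤ r) (h : r ≤ s) :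
    cpcyl z r ⊆ cpcyl z s := by
  intro y hy
  obtain ⟨h1, h2, h3⟩ := mem_cpcyl.1 hy
  exact mem_cpcyl.2 ⟨h1.trans h, by nlinarith, h3⟩

/-- Interior gradient estimate when the right-hand side grows at most linearly in the gradient. -/
theorem exists_norm_spD_le_of_linear_growth (n : ℕ) (E : Type*) [NormedAddCommGroup E]
    [NormedSpace ℝ E] {A B r : ℝ} (hA : 0 ≤ A) (hB : 0 < B) (hr : 0 < r) :
    ∃ C : ℝ, 0 < C ∧ ∀ (U : Set (Sp n × ℝ)) (v : Sp n × ℝ → E) (z₀ : Sp n × ℝ), IsOpen U →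
      ContDiffOn ℝ ∞ v U → cpcyl z₀ r ⊆ U → (∀ z ∈ cpcyl z₀ r, ‖v z‖ ≤ B) →
      (∀ z ∈ cpcyl z₀ r, ‖heatOp v z‖ ≤ A * (1 + ‖spD v z‖)) → ‖spD v z₀‖ ≤ C := by
  set σ : ℝ := 1 / (2 + 2 * n * A * r) with hσ
  have hden : 0 < 2 + 2 * n * A * r := by positivity
  have hσ0 : 0 < σ := by positivity
  have hσ1 : σ ≤ 1 / 2 := by
    rw [hσ]
    exact one_div_le_one_div_of_le (by norm_num) (by nlinarith [show 0 ≤ 2 * n * A * r by positivity])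
  have hσ2 : n * A * r * σ ≤ 1 / 2 := by
    rw [hσ, mul_one_div, div_le_iff₀ hden]; linarith
  refine ⟨(2 * (n * ((n + 1) * B)) / σ + r / 2) / r, by positivity, ?_⟩
  intro U v z₀ hU hv hsub hvB hvA
  by_cases h0 : 0 < ‖spD v z₀‖
  swap
  · exact (not_lt.1 h0).trans (by positivity)
  obtain ⟨z, ρ, hρ, hρr, hzsub, hle, hpick⟩ := exists_point_picking hr
    (f := fun z => ‖spD v z‖) (((hv.spD hU).continuousOn.mono hsub).norm) h0
  set L := ‖spD v z‖ with hL
  set s := σ * ρ with hs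
  have hs0 : 0 < s := by positivity
  have hsρ : s ≤ ρ / 2 := by rw [hs]; nlinarith
  have hss : cpcyl z s ⊆ cpcyl z (ρ / 2) := cpcyl_subset_cpcyl z hs0.le hsρ
  have hss' : cpcyl z s ⊆ cpcyl z₀ r := (cpcyl_subset_cpcyl z hs0.le (by linarith)).trans hzsub
  have key := norm_spD_le_of_heatOp_bound hU hv (z₀ := z) (d := s) (M := B)
    (F := A * (1 + 2 * L)) hs0 hB (hss'.trans hsub) (fun y hy => hvB y (hss' hy))
    (fun y hy => (hvA y (hss' hy)).trans
      (mul_le_mul_of_nonneg_left (by linarith [hpick y (hss hy)]) hA))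
  have hL0 : 0 ≤ L := norm_nonneg _
  have hnAs : n * A * s ≤ 1 / 2 := by
    refine le_trans ?_ hσ2
    rw [hs, mul_comm σ ρ, ← mul_assoc]
    gcongr
  have h2 : L ≤ n * ((n + 1) * B) / s + 1 / 4 + L / 2 := by
    calc L ≤ n * ((n + 1) * B / s + A * (1 + 2 * L) * s / 2) := key
      _ = n * ((n + 1) * B) / s + n * A * s * (1 / 2 + L) := by ring
      _ ≤ n * ((n + 1) * B) / s + 1 / 2 * (1 / 2 + L) := by gcongr
      _ = _ := by ring
  have h3 : ρ * L ≤ 2 * (n * ((n + 1) * B)) / σ + r / 2 := by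
    have : ρ * L ≤ ρ * (2 * (n * ((n + 1) * B)) / s + 1 / 2) := by
      refine mul_le_mul_of_nonneg_left ?_ hρ.le
      rw [mul_div_assoc]; linarith
    refine this.trans ?_
    have e : ρ * (2 * (n * ((n + 1) * B)) / s + 1 / 2) =
        2 * (n * ((n + 1) * B)) / σ + ρ / 2 := by
      rw [hs]; field_simp
    rw [e]; linarith
  rw [le_div_iff₀ hr]
  linarith

end GradientEstimate

section Prolongation

variable {n : ℕ} {E : Type*} [NormedAddCommGroup E] [NormedSpace ℝ E]

/-- The pair formed by a map and its spatial derivative. -/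
def prolong (v : Sp n × ℝ → E) (z : Sp n × ℝ) : E × (Sp n →L[ℝ] E) := (v z, spD v z)

/-- `v` solves the semilinear heat equation `∂ₜv - Δv = G(v, Dv)` on `U`. -/
def IsSemilinearSol (G : E × (Sp n →L[ℝ] E) → E) (v : Sp n × ℝ → E) (U : Set (Sp n × ℝ)) : Prop :=
  ∀ z ∈ U, heatOp v z = G (prolong v z)

/-- The nonlinearity of the equation solved by the prolongation of a solution. -/
def prolongNonlin (G : E × (Sp n →L[ℝ] E) → E)
    (q : (E × (Sp n →L[ℝ] E)) × (Sp n →L[ℝ] E × (Sp n →L[ℝ] E))) : E × (Sp n →L[ℝ] E) :=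
  (G q.1, (fderiv ℝ G q.1).comp q.2)

lemma contDiff_prolongNonlin {G : E × (Sp n →L[ℝ] E) → E} (hG : ContDiff ℝ ∞ G) :
    ContDiff ℝ ∞ (prolongNonlin G) :=
  (hG.comp contDiff_fst).prodMk
    (((hG.fderiv_right (m := ∞) (by simp)).comp contDiff_fst).clm_comp contDiff_snd)

lemma contDiffOn_prolong {U : Set (Sp n × ℝ)} (hU : IsOpen U) {v : Sp n × ℝ → E}
    (hv : ContDiffOn ℝ ∞ v U) : ContDiffOn ℝ ∞ (prolong v) U :=
  hv.prodMk (hv.spD hU)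

lemma fderiv_comm {U : Set (Sp n × ℝ)} (hU : IsOpen U) {v : Sp n × ℝ → E}
    (hv : ContDiffOn ℝ ∞ v U) {z : Sp n × ℝ} (hz : z ∈ U) (e e' : Sp n × ℝ) :
    fderiv ℝ (fun w => fderiv ℝ v w e) z e' = fderiv ℝ (fun w => fderiv ℝ v w e') z e := by
  have hsymm : IsSymmSndFDerivAt ℝ v z :=
    (hv.contDiffAt (hU.mem_nhds hz)).isSymmSndFDerivAt
      (by rw [minSmoothness_of_isRCLikeNormedField]; exact WithTop.coe_le_coe.2 (le_top : (2 : ℕ∞) ≤ ⊤))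
  have hd := (hv.fderiv_infty hU).differentiableAt_of_isOpen hU hz
  have h : ∀ a b, fderiv ℝ (fun w => fderiv ℝ v w a) z b = fderiv ℝ (fderiv ℝ v) z b a := by
    intro a b
    rw [fderiv_clm_apply hd (differentiableAt_const a)]
    simp
  rw [h, h, hsymm.eq]

lemma contDiffOn_fderiv_apply {U : Set (Sp n × ℝ)} (hU : IsOpen U) {v : Sp n × ℝ → E}
    (hv : ContDiffOn ℝ ∞ v U) (e : Sp n × ℝ) : ContDiffOn ℝ ∞ (fun w => fderiv ℝ v w e) U :=
  (hv.fderiv_infty hU).clm_apply contDiffOn_const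

/-- The heat operator commutes with directional derivatives. -/
lemma heatOp_fderiv_apply {U : Set (Sp n × ℝ)} (hU : IsOpen U) {v : Sp n × ℝ → E}
    (hv : ContDiffOn ℝ ∞ v U) {z : Sp n × ℝ} (hz : z ∈ U) (e : Sp n × ℝ) :
    heatOp (fun w => fderiv ℝ v w e) z = fderiv ℝ (heatOp v) z e := by
  have hdd : ∀ a b : Sp n × ℝ,
      DifferentiableAt ℝ (fun y => fderiv ℝ (fun w => fderiv ℝ v w a) y b) z := fun a b =>
    (contDiffOn_fderiv_apply hU hv a).differentiableAt_fderiv_apply hU hz b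
  have hlap : DifferentiableAt ℝ (spLap v) z := by
    unfold spLap
    exact DifferentiableAt.fun_sum fun α _ => hdd _ _
  have h1 : fderiv ℝ (heatOp v) z e =
      fderiv ℝ (fun w => fderiv ℝ v w (tdir n)) z e - fderiv ℝ (spLap v) z e := by
    have : heatOp v = fun w => fderiv ℝ v w (tdir n) - spLap v w := rfl
    rw [this, fderiv_fun_sub (hv.differentiableAt_fderiv_apply hU hz _) hlap]
    rfl
  have h2 : fderiv ℝ (spLap v) z e = spLap (fun w => fderiv ℝ v w e) z := by
    have : spLap v = fun w => ∑ α : Fin n,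
      fderiv ℝ (fun y => fderiv ℝ v y (sdir n α)) w (sdir n α) := rfl
    rw [this, fderiv_fun_sum fun α _ => hdd _ _, sum_apply, spLap]
    refine Finset.sum_congr rfl fun α _ => ?_
    rw [fderiv_comm hU (contDiffOn_fderiv_apply hU hv _) hz]
    have : (fun w => fderiv ℝ (fun y => fderiv ℝ v y (sdir n α)) w e) =ᶠ[𝓝 z]
        fun w => fderiv ℝ (fun y => fderiv ℝ v y e) w (sdir n α) := by
      filter_upwards [hU.mem_nhds hz] with w hw using fderiv_comm hU hv hw _ _
    rw [this.fderiv_eq]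
  rw [h1, h2, heatOp, fderiv_comm hU hv hz]

lemma heatOp_spD_apply {U : Set (Sp n × ℝ)} (hU : IsOpen U) {v : Sp n × ℝ → E}
    (hv : ContDiffOn ℝ ∞ v U) {z : Sp n × ℝ} (hz : z ∈ U) (x : Sp n) :
    heatOp (spD v) z x = fderiv ℝ (heatOp v) z (x, 0) := by
  rw [← heatOp_fderiv_apply hU hv hz]
  exact (heatOp_clm_comp (ContinuousLinearMap.apply ℝ E x) hU (hv.spD hU) hz).symm

theorem IsSemilinearSol.prolong {U : Set (Sp n × ℝ)} (hU : IsOpen U) {v : Sp n × ℝ → E}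
    (hv : ContDiffOn ℝ ∞ v U) {G : E × (Sp n →L[ℝ] E) → E} (hG : ContDiff ℝ ∞ G)
    (h : IsSemilinearSol G v U) : IsSemilinearSol (prolongNonlin G) (prolong v) U := by
  intro z hz
  have hp := contDiffOn_prolong hU hv
  have h1 : (heatOp (_root_.prolong v) z).1 = heatOp v z :=
    (heatOp_clm_comp (ContinuousLinearMap.fst ℝ E (Sp n →L[ℝ] E)) hU hp hz).symm
  have h2 : (heatOp (_root_.prolong v) z).2 = heatOp (spD v) z :=
    (heatOp_clm_comp (ContinuousLinearMap.snd ℝ E (Sp n →L[ℝ] E)) hU hp hz).symm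
  refine Prod.ext (h1.trans (h z hz)) (h2.trans ?_)
  ext1 x
  rw [heatOp_spD_apply hU hv hz]
  have heq : heatOp v =ᶠ[𝓝 z] G ∘ _root_.prolong v := by
    filter_upwards [hU.mem_nhds hz] with w hw using h w hw
  rw [heq.fderiv_eq, fderiv_comp z (hG.differentiable (by simp) _)
    (hp.differentiableAt_of_isOpen hU hz)]
  rfl

/-- Bounds on a solution and its gradient propagate to one more derivative. -/
theorem exists_norm_prolong_prolong_le [FiniteDimensional ℝ E] {G : E × (Sp n →L[ℝ] E) → E}
    (hG : ContDiff ℝ ∞ G) {B r : ℝ} (hB : 0 < B) (hr : 0 < r) :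
    ∃ C : ℝ, 0 < C ∧ ∀ (U : Set (Sp n × ℝ)) (v : Sp n × ℝ → E) (z₀ : Sp n × ℝ), IsOpen U →
      ContDiffOn ℝ ∞ v U → IsSemilinearSol G v U → cpcyl z₀ r ⊆ U →
      (∀ z ∈ cpcyl z₀ r, ‖prolong v z‖ ≤ B) →
      ∀ z ∈ cpcyl z₀ (r / 2), ‖prolong (prolong v) z‖ ≤ C := by
  have : ProperSpace (E × (Sp n →L[ℝ] E)) := FiniteDimensional.proper_real _
  have hK : IsCompact (closedBall (0 : E × (Sp n →L[ℝ] E)) B) := isCompact_closedBall _ _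
  obtain ⟨A₁, hA₁⟩ := hK.exists_bound_of_continuousOn hG.continuous.continuousOn
  obtain ⟨A₂, hA₂⟩ := hK.exists_bound_of_continuousOn
    (hG.continuous_fderiv (by simp)).continuousOn
  have h0 : (0 : E × (Sp n →L[ℝ] E)) ∈ closedBall 0 B := by simp [hB.le]
  have hA₁0 : 0 ≤ A₁ := (norm_nonneg _).trans (hA₁ 0 h0)
  have hA₂0 : 0 ≤ A₂ := (norm_nonneg _).trans (hA₂ 0 h0)
  obtain ⟨C, hC, hest⟩ := exists_norm_spD_le_of_linear_growth n (E × (Sp n →L[ℝ] E))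
    (add_nonneg hA₁0 hA₂0) hB (half_pos hr)
  refine ⟨max B C, lt_max_of_lt_right hC, fun U v z₀ hU hv hsol hsub hvB z hz => ?_⟩
  have hzr : cpcyl z (r / 2) ⊆ cpcyl z₀ r := by
    intro y hy
    obtain ⟨h1, h2, h3⟩ := mem_cpcyl.1 hy
    obtain ⟨g1, g2, g3⟩ := mem_cpcyl.1 hz
    have := norm_sub_le_norm_sub_add_norm_sub y.1 z.1 z₀.1
    exact mem_cpcyl.2 ⟨by linarith, by nlinarith, h3.trans g3⟩
  have hz' := hzr (self_mem_cpcyl z (half_pos hr).le)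
  refine max_le_max (hvB z hz') (hest U (prolong v) z hU (contDiffOn_prolong hU hv)
    (hzr.trans hsub) (fun y hy => hvB y (hzr hy)) fun y hy => ?_)
  have hyB := hvB y (hzr hy)
  have hyb : prolong v y ∈ closedBall 0 B := by simpa using hyB
  rw [hsol.prolong hU hv hG y (hsub (hzr hy))]
  have e1 := hA₁ _ hyb
  have e2 := hA₂ _ hyb
  have hq := norm_nonneg (spD (prolong v) y)
  refine max_le ?_ ?_
  · exact e1.trans (by nlinarith)
  · refine (ContinuousLinearMap.opNorm_comp_le _ _).trans ?_
    change ‖fderiv ℝ G (prolong v y)‖ * ‖spD (prolong v) y‖ ≤ _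
    nlinarith

lemma fderiv_slice {v : Sp n × ℝ → E} {x : Sp n} {t : ℝ} (hv : DifferentiableAt ℝ v (x, t)) :
    fderiv ℝ (fun y => v (y, t)) x = spD v (x, t) :=
  (hv.hasFDerivAt.comp x (hasFDerivAt_prodMk_left x t)).fderiv

end Prolongation

/-- Bounds on a solution of a semilinear heat equation and its gradient imply interior bounds on
all spatial derivatives. -/
theorem exists_norm_iteratedFDeriv_le {n : ℕ} (m : ℕ) :
    ∀ (E : Type) [NormedAddCommGroup E] [NormedSpace ℝ E] [FiniteDimensional ℝ E]
      (G : E × (Sp n →L[ℝ] E) → E), ContDiff ℝ ∞ G → ∀ B r : ℝ, 0 < B → 0 < r →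
    ∃ C : ℝ, 0 < C ∧ ∀ (U : Set (Sp n × ℝ)) (v : Sp n × ℝ → E) (z₀ : Sp n × ℝ), IsOpen U →
      ContDiffOn ℝ ∞ v U → IsSemilinearSol G v U → cpcyl z₀ r ⊆ U →
      (∀ z ∈ cpcyl z₀ r, ‖prolong v z‖ ≤ B) →
      ‖iteratedFDeriv ℝ m (fun x => v (x, z₀.2)) z₀.1‖ ≤ C := by
  induction m with
  | zero =>
    intro E _ _ _ G _ B r hB hr
    refine ⟨B, hB, fun U v z₀ _ _ _ _ hvB => ?_⟩
    rw [norm_iteratedFDeriv_zero]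
    exact (norm_fst_le (prolong v z₀)).trans (hvB z₀ (self_mem_cpcyl z₀ hr.le))
  | succ m ih =>
    intro E _ _ _ G hG B r hB hr
    obtain ⟨C₁, hC₁, h1⟩ := exists_norm_prolong_prolong_le hG hB hr
    obtain ⟨C, hC, h2⟩ := ih (E × (Sp n →L[ℝ] E)) (prolongNonlin G) (contDiff_prolongNonlin hG)
      C₁ (r / 2) hC₁ (half_pos hr)
    refine ⟨C, hC, fun U v z₀ hU hv hsol hsub hvB => ?_⟩
    have hp := contDiffOn_prolong hU hv
    have hz₀ := hsub (self_mem_cpcyl z₀ hr.le)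
    have h3 := h2 U (prolong v) z₀ hU hp (hsol.prolong hU hv hG)
      ((cpcyl_subset_cpcyl z₀ (half_pos hr).le (by linarith)).trans hsub)
      (h1 U v z₀ hU hv hsol hsub hvB)
    have hcont : Continuous fun x : Sp n => (x, z₀.2) := by fun_prop
    have heq : fderiv ℝ (fun x => v (x, z₀.2)) =ᶠ[𝓝 z₀.1]
        (ContinuousLinearMap.snd ℝ E (Sp n →L[ℝ] E)) ∘ fun x => prolong v (x, z₀.2) := by
      filter_upwards [hcont.continuousAt.eventually_mem (hU.mem_nhds hz₀)] with x hx
      exact fderiv_slice (hv.differentiableAt_of_isOpen hU hx)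
    rw [← norm_iteratedFDeriv_fderiv, (heq.iteratedFDeriv ℝ m).eq_of_nhds]
    have hslice : ContDiffAt ℝ ∞ (fun x => prolong v (x, z₀.2)) z₀.1 :=
      (hp.contDiffAt (hU.mem_nhds hz₀)).comp z₀.1 (contDiff_prodMk_left z₀.2).contDiffAt
    refine (ContinuousLinearMap.norm_iteratedFDeriv_comp_left _ hslice
      (by exact_mod_cast le_top)).trans ?_
    refine (mul_le_of_le_one_left (norm_nonneg _) (ContinuousLinearMap.norm_snd_le _ _ _)).trans h3

/-- Interior Lipschitz estimate in space-time for a solution and its spatial derivative. -/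
theorem exists_norm_prolong_sub_le {n : ℕ} {E : Type*} [NormedAddCommGroup E] [NormedSpace ℝ E]
    [FiniteDimensional ℝ E] {G : E × (Sp n →L[ℝ] E) → E} (hG : ContDiff ℝ ∞ G) {B r : ℝ}
    (hB : 0 < B) (hr : 0 < r) :
    ∃ C : ℝ, 0 ≤ C ∧ ∀ (U : Set (Sp n × ℝ)) (v : Sp n × ℝ → E) (z₀ : Sp n × ℝ), IsOpen U →
      ContDiffOn ℝ ∞ v U → IsSemilinearSol G v U → cpcyl z₀ r ⊆ U →
      (∀ z ∈ cpcyl z₀ r, ‖prolong v z‖ ≤ B) →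
      ∀ z ∈ cpcyl z₀ (r / 2 / 2), ‖prolong v z - prolong v z₀‖ ≤ C * ‖z - z₀‖ := by
  obtain ⟨C₁, hC₁, h1⟩ := exists_norm_prolong_prolong_le hG hB hr
  have hG' := contDiff_prolongNonlin hG
  obtain ⟨C₂, hC₂, h2⟩ := exists_norm_prolong_prolong_le hG' hC₁ (half_pos hr)
  have : ProperSpace ((E × (Sp n →L[ℝ] E)) × (Sp n →L[ℝ] E × (Sp n →L[ℝ] E))) :=
    FiniteDimensional.proper_real ((E × (Sp n →L[ℝ] E)) × (Sp n →L[ℝ] E × (Sp n →L[ℝ] E)))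
  obtain ⟨A, hA⟩ := (isCompact_closedBall (0 : (E × (Sp n →L[ℝ] E)) ×
    (Sp n →L[ℝ] E × (Sp n →L[ℝ] E))) C₁).exists_bound_of_continuousOn hG'.continuous.continuousOn
  have hA0 : 0 ≤ A := (norm_nonneg _).trans (hA 0 (by simp [hC₁.le]))
  refine ⟨C₁ + (n * C₂ + A), by positivity, fun U v z₀ hU hv hsol hsub hvB z hz => ?_⟩
  have hs1 : cpcyl z₀ (r / 2) ⊆ U :=
    (cpcyl_subset_cpcyl z₀ (by positivity) (by linarith)).trans hsub
  have hs2' : cpcyl z₀ (r / 2 / 2) ⊆ cpcyl z₀ (r / 2) :=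
    cpcyl_subset_cpcyl z₀ (by positivity) (by linarith)
  have hp := contDiffOn_prolong hU hv
  have hpp := contDiffOn_prolong hU hp
  have hsol' := hsol.prolong hU hv hG
  have b1 := h1 U v z₀ hU hv hsol hsub hvB
  have b2 := h2 U (prolong v) z₀ hU hp hsol' hs1 b1
  refine Convex.norm_image_sub_le_of_norm_fderiv_le (𝕜 := ℝ) (s := cpcyl z₀ (r / 2 / 2))
    (fun y hy => hp.differentiableAt_of_isOpen hU (hs1 (hs2' hy))) (fun y hy => ?_)
    ((convex_closedBall _ _).prod (convex_Icc _ _)) (self_mem_cpcyl z₀ (by positivity)) hz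
  have hyU := hs1 (hs2' hy)
  have hy1 := b1 y (hs2' hy)
  have hy2 := b2 y hy
  have hlap : ‖spLap (prolong v) y‖ ≤ n * C₂ := by
    refine (norm_sum_le _ _).trans ?_
    refine (Finset.sum_le_card_nsmul _ _ C₂ fun α _ => ?_).trans (by simp)
    set l : (E × (Sp n →L[ℝ] E)) × (Sp n →L[ℝ] E × (Sp n →L[ℝ] E)) →L[ℝ] E × (Sp n →L[ℝ] E) :=
      (ContinuousLinearMap.apply ℝ (E × (Sp n →L[ℝ] E)) (EuclideanSpace.single α (1 : ℝ))).comp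
        (ContinuousLinearMap.snd ℝ _ _) with hl
    have e1 : (fun w => fderiv ℝ (prolong v) w (sdir n α)) =
        fun w => l (prolong (prolong v) w) := rfl
    rw [e1, fderiv_clm_comp_apply l (hpp.differentiableAt_of_isOpen hU hyU)]
    have e2 : l (fderiv ℝ (prolong (prolong v)) y (sdir n α)) =
        (spD (prolong (prolong v)) y (EuclideanSpace.single α 1)).2
          (EuclideanSpace.single α 1) := rfl
    rw [e2]
    calc _ ≤ ‖(spD (prolong (prolong v)) y (EuclideanSpace.single α 1)).2‖ *
          ‖EuclideanSpace.single α (1 : ℝ)‖ := ContinuousLinearMap.le_opNorm _ _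
      _ ≤ ‖spD (prolong (prolong v)) y (EuclideanSpace.single α 1)‖ := by
          simpa using norm_snd_le _
      _ ≤ ‖spD (prolong (prolong v)) y‖ * ‖EuclideanSpace.single α (1 : ℝ)‖ :=
          ContinuousLinearMap.le_opNorm _ _
      _ ≤ C₂ := by
          have h : ‖spD (prolong (prolong v)) y‖ ≤ C₂ :=
            (norm_snd_le (prolong (prolong (prolong v)) y)).trans hy2
          simpa using h
  have htime : ‖fderiv ℝ (prolong v) y (tdir n)‖ ≤ n * C₂ + A := by
    have e := hsol' y hyU
    rw [heatOp, sub_eq_iff_eq_add'] at e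
    rw [e]
    exact (norm_add_le _ _).trans (add_le_add hlap (hA _ (mem_closedBall_zero_iff.2 hy1)))
  refine ContinuousLinearMap.opNorm_le_bound _ (by positivity) fun x => ?_
  have hx : x = (x.1, (0 : ℝ)) + x.2 • tdir n := by ext1 <;> simp [tdir]
  have hfx : fderiv ℝ (prolong v) y x =
      spD (prolong v) y x.1 + x.2 • fderiv ℝ (prolong v) y (tdir n) := by
    conv_lhs => rw [hx]
    rw [map_add, map_smul]; rfl
  rw [hfx, add_mul]
  refine (norm_add_le _ _).trans (add_le_add ?_ ?_)
  · exact (ContinuousLinearMap.le_opNorm _ _).trans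
      (mul_le_mul ((norm_snd_le (prolong (prolong v) y)).trans hy1) (norm_fst_le x)
        (norm_nonneg _) hC₁.le)
  · rw [norm_smul, mul_comm]
    exact mul_le_mul htime (norm_snd_le x) (norm_nonneg _) (by positivity)

section Scaling

variable {n : ℕ} {E : Type*} [NormedAddCommGroup E] [NormedSpace ℝ E]

/-- Parabolic scaling by `c` followed by translation by `z`. -/
def parScale (z : Sp n × ℝ) (c : ℝ) (y : Sp n × ℝ) : Sp n × ℝ :=
  (z.1 + c • y.1, z.2 + c ^ 2 * y.2)

lemma contDiff_parScale (z : Sp n × ℝ) (c : ℝ) : ContDiff ℝ ∞ (parScale z c) := by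
  unfold parScale; fun_prop

lemma hasFDerivAt_parScale (z : Sp n × ℝ) (c : ℝ) (y : Sp n × ℝ) :
    HasFDerivAt (parScale z c) ((c • ContinuousLinearMap.fst ℝ (Sp n) ℝ).prod
      (c ^ 2 • ContinuousLinearMap.snd ℝ (Sp n) ℝ)) y :=
  ((hasFDerivAt_fst.const_smul c).const_add z.1).prodMk
    ((hasFDerivAt_snd.const_smul (c ^ 2)).const_add z.2)

lemma fderiv_comp_parScale {v : Sp n × ℝ → E} {z y : Sp n × ℝ} {c : ℝ}
    (hv : DifferentiableAt ℝ v (parScale z c y)) (e : Sp n × ℝ) :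
    fderiv ℝ (fun w => v (parScale z c w)) y e =
      fderiv ℝ v (parScale z c y) (c • e.1, c ^ 2 * e.2) := by
  have := (hv.hasFDerivAt.comp y (hasFDerivAt_parScale z c y)).fderiv
  rw [Function.comp_def] at this
  rw [this]; rfl

lemma fderiv_comp_parScale_space {v : Sp n × ℝ → E} {z y : Sp n × ℝ} {c : ℝ}
    (hv : DifferentiableAt ℝ v (parScale z c y)) (x : Sp n) :
    fderiv ℝ (fun w => v (parScale z c w)) y (x, 0) =
      c • fderiv ℝ v (parScale z c y) (x, 0) := by
  rw [fderiv_comp_parScale hv, ← map_smul]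
  simp

lemma spD_comp_parScale {v : Sp n × ℝ → E} {z y : Sp n × ℝ} {c : ℝ}
    (hv : DifferentiableAt ℝ v (parScale z c y)) :
    spD (fun w => v (parScale z c w)) y = c • spD v (parScale z c y) := by
  ext1 x
  exact fderiv_comp_parScale_space hv x

lemma heatOp_comp_parScale {U : Set (Sp n × ℝ)} (hU : IsOpen U) {v : Sp n × ℝ → E}
    (hv : ContDiffOn ℝ ∞ v U) {z y : Sp n × ℝ} {c : ℝ} (hy : parScale z c y ∈ U) :
    heatOp (fun w => v (parScale z c w)) y = c ^ 2 • heatOp v (parScale z c y) := by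
  rw [heatOp, heatOp, smul_sub, fderiv_comp_parScale (hv.differentiableAt_of_isOpen hU hy)]
  congr 1
  · rw [← map_smul]
    simp [tdir]
  · rw [spLap, spLap, Finset.smul_sum]
    refine Finset.sum_congr rfl fun α _ => ?_
    have heq : (fun w => fderiv ℝ (fun w => v (parScale z c w)) w (sdir n α)) =ᶠ[𝓝 y]
        fun w => c • (fun w => fderiv ℝ v w (sdir n α)) (parScale z c w) := by
      filter_upwards [(contDiff_parScale z c).continuous.continuousAt.eventually_mem
        (hU.mem_nhds hy)] with w hw
      exact fderiv_comp_parScale_space (hv.differentiableAt_of_isOpen hU hw) _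
    have hd := hv.differentiableAt_fderiv_apply hU hy (sdir n α)
    have hd' : DifferentiableAt ℝ (fun w => (fun w => fderiv ℝ v w (sdir n α)) (parScale z c w)) y :=
      hd.comp y (hasFDerivAt_parScale z c y).differentiableAt
    rw [heq.fderiv_eq, fderiv_fun_const_smul hd', pow_two, mul_smul]
    exact congrArg (c • ·) (fderiv_comp_parScale_space hd _)

lemma parScale_mem_cpcyl {z y : Sp n × ℝ} {c r : ℝ} (hc : 0 ≤ c) (hy : y ∈ cpcyl 0 r) :
    parScale z c y ∈ cpcyl z (c * r) := by
  obtain ⟨h1, h2, h3⟩ := mem_cpcyl.1 hy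
  simp only [Prod.fst_zero, Prod.snd_zero, sub_zero, zero_sub] at h1 h2 h3
  refine mem_cpcyl.2 ⟨?_, ?_, ?_⟩
  · simpa [parScale, norm_smul, abs_of_nonneg hc] using mul_le_mul_of_nonneg_left h1 hc
  · have := mul_le_mul_of_nonneg_left h2 (sq_nonneg c)
    simp only [parScale]
    linarith
  · have := mul_le_mul_of_nonneg_left h3 (sq_nonneg c)
    simp only [parScale]
    linarith

lemma exists_parScale_eq {z y : Sp n × ℝ} {c r : ℝ} (hc : 0 < c) (hy : y ∈ cpcyl z (c * r)) :
    ∃ w ∈ cpcyl (0 : Sp n × ℝ) r, parScale z c w = y := by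
  obtain ⟨h1, h2, h3⟩ := mem_cpcyl.1 hy
  refine ⟨(c⁻¹ • (y.1 - z.1), (c ^ 2)⁻¹ * (y.2 - z.2)), mem_cpcyl.2 ⟨?_, ?_, ?_⟩, ?_⟩
  · simp only [Prod.fst_zero, sub_zero, norm_smul, norm_inv, Real.norm_eq_abs, abs_of_pos hc]
    rwa [inv_mul_le_iff₀ hc]
  · simp only [Prod.snd_zero, zero_sub]
    rw [le_inv_mul_iff₀ (by positivity)]
    linarith
  · simp only [Prod.snd_zero]
    rw [inv_mul_le_iff₀ (by positivity)]
    linarith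
  · ext1
    · simp [parScale, smul_smul, hc.ne']
    · simp [parScale, hc.ne']

end Scaling

/-! ### The harmonic map heat flow -/

section HarmonicMap

variable {n k : ℕ}

/-- The nonlinearity `|p|² u` of the harmonic map heat flow into a sphere. -/
def sphereNonlin (n k : ℕ) (q : (Fin k → ℝ) × (Sp n →L[ℝ] (Fin k → ℝ))) : Fin k → ℝ :=
  (∑ α : Fin n, ∑ i : Fin k, (q.2 (EuclideanSpace.single α 1) i) ^ 2) • q.1

lemma contDiff_sphereNonlin : ContDiff ℝ ∞ (sphereNonlin n k) := by
  have h : ∀ (α : Fin n) (i : Fin k), ContDiff ℝ ∞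
      fun q : (Fin k → ℝ) × (Sp n →L[ℝ] (Fin k → ℝ)) => q.2 (EuclideanSpace.single α 1) i :=
    fun α i => ((ContinuousLinearMap.proj (R := ℝ) (φ := fun _ : Fin k => ℝ) i).comp
      ((ContinuousLinearMap.apply ℝ (Fin k → ℝ) (EuclideanSpace.single α (1 : ℝ))).comp
        (ContinuousLinearMap.snd ℝ (Fin k → ℝ) (Sp n →L[ℝ] (Fin k → ℝ))))).contDiff
  exact (ContDiff.sum fun α _ => ContDiff.sum fun i _ => (h α i).pow 2).smul contDiff_fst

lemma pd_eq {u : Sp n × ℝ → Fin k → ℝ} {z : Sp n × ℝ} (hu : DifferentiableAt ℝ u z) (i : Fin k)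
    (e : Sp n × ℝ) : pd u i e z = fderiv ℝ u z e i :=
  fderiv_clm_comp_apply (ContinuousLinearMap.proj (R := ℝ) (φ := fun _ : Fin k => ℝ) i) hu e

lemma gradSq_eq {u : Sp n × ℝ → Fin k → ℝ} {z : Sp n × ℝ} (hu : DifferentiableAt ℝ u z) :
    gradSq u z = ∑ α : Fin n, ∑ i : Fin k, (spD u z (EuclideanSpace.single α 1) i) ^ 2 := by
  simp only [gradSq, pd_eq hu]
  rfl

lemma HeatFlow.isSemilinearSol {u : Sp n × ℝ → Fin k → ℝ} {U : Set (Sp n × ℝ)} (hU : IsOpen U)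
    (hu : ContDiffOn ℝ ∞ u U) (h : HeatFlow u U) : IsSemilinearSol (sphereNonlin n k) u U := by
  intro z hz
  have hd := hu.differentiableAt_of_isOpen hU hz
  ext i
  have h1 := h z hz i
  have h2 : lap u i z = spLap u z i :=
    spLap_clm_comp (ContinuousLinearMap.proj (R := ℝ) (φ := fun _ : Fin k => ℝ) i) hU hu hz
  rw [h2, pd_eq hd, gradSq_eq hd] at h1
  simp only [heatOp, Pi.sub_apply, h1, sphereNonlin, Pi.smul_apply, smul_eq_mul, prolong]
  ring

lemma norm_spD_sq_le_gradSq {u : Sp n × ℝ → Fin k → ℝ} {z : Sp n × ℝ}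
    (hu : DifferentiableAt ℝ u z) : ‖spD u z‖ ^ 2 ≤ gradSq u z := by
  rw [gradSq_eq hu]
  set T := spD u z
  set S := ∑ α : Fin n, ∑ i : Fin k, (T (EuclideanSpace.single α 1) i) ^ 2 with hS
  have hS0 : 0 ≤ S := by positivity
  rw [← Real.le_sqrt (norm_nonneg _) hS0]
  refine T.opNorm_le_bound (Real.sqrt_nonneg _) fun x => ?_
  refine (pi_norm_le_iff_of_nonneg (by positivity)).2 fun i => ?_
  have hx : x = ∑ α, x α • EuclideanSpace.single α (1 : ℝ) := by
    simpa using ((EuclideanSpace.basisFun (Fin n) ℝ).sum_repr x).symm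
  have hT : T x i = ∑ α, T (EuclideanSpace.single α (1 : ℝ)) i * x α := by
    conv_lhs => rw [hx]
    simp [mul_comm]
  rw [Real.norm_eq_abs, hT]
  refine abs_le_of_sq_le_sq ?_ (by positivity)
  rw [mul_pow, Real.sq_sqrt hS0, EuclideanSpace.real_norm_sq_eq]
  refine (Finset.sum_mul_sq_le_sq_mul_sq _ _ _).trans ?_
  gcongr
  exact Finset.sum_le_sum fun α _ =>
    Finset.single_le_sum (f := fun j => T (EuclideanSpace.single α 1) j ^ 2)
      (fun j _ => sq_nonneg _) (Finset.mem_univ i)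

/-- A solution whose gradient is comparable to `L` at a point and at most `2L` nearby keeps a
gradient of size at least `L / 2` on a cylinder of radius comparable to `1 / L`. -/
theorem exists_half_le_norm_spD (n k : ℕ) :
    ∃ η : ℝ, 0 < η ∧ η ≤ 1 / 8 ∧ ∀ (U : Set (Sp n × ℝ)) (v : Sp n × ℝ → Fin k → ℝ) (z : Sp n × ℝ)
      (L : ℝ), 0 < L → IsOpen U → ContDiffOn ℝ ∞ v U → IsSemilinearSol (sphereNonlin n k) v U →
      cpcyl z (L⁻¹ * (1 / 2)) ⊆ U → (∀ y ∈ cpcyl z (L⁻¹ * (1 / 2)), ‖v y‖ ≤ 1) →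
      (∀ y ∈ cpcyl z (L⁻¹ * (1 / 2)), ‖spD v y‖ ≤ 2 * L) → ‖spD v z‖ = L →
      ∀ y ∈ cpcyl z (L⁻¹ * η), L / 2 ≤ ‖spD v y‖ := by
  obtain ⟨C, hC, hest⟩ := exists_norm_prolong_sub_le (contDiff_sphereNonlin (n := n) (k := k))
    (B := 2) (r := 1 / 2) two_pos (by norm_num)
  refine ⟨1 / (8 + 2 * C), by positivity,
    one_div_le_one_div_of_le (by norm_num) (by linarith), ?_⟩
  intro U v z L hL hU hv hsol hsub hv1 hvD hvz y hy
  obtain ⟨w, hw, rfl⟩ := exists_parScale_eq (inv_pos.2 hL) hy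
  set c := L⁻¹ with hc
  have hc0 : 0 < c := inv_pos.2 hL
  set U' := parScale z c ⁻¹' U with hU'
  set v' : Sp n × ℝ → Fin k → ℝ := fun y => v (parScale z c y) with hv'
  have hUo : IsOpen U' := hU.preimage (contDiff_parScale z c).continuous
  have hv's : ContDiffOn ℝ ∞ v' U' :=
    hv.comp (contDiff_parScale z c).contDiffOn fun y hy => hy
  have hspD : ∀ y ∈ U', spD v' y = c • spD v (parScale z c y) := fun y hy =>
    spD_comp_parScale (hv.differentiableAt_of_isOpen hU hy)
  have hsol' : IsSemilinearSol (sphereNonlin n k) v' U' := by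
    intro y hy
    rw [heatOp_comp_parScale hU hv hy, hsol _ hy]
    ext i
    simp [sphereNonlin, prolong, hspD y hy, v', mul_pow, Finset.mul_sum, mul_assoc,
      Finset.sum_mul]
  have hsub' : cpcyl (0 : Sp n × ℝ) (1 / 2) ⊆ U' := fun y hy =>
    hsub (parScale_mem_cpcyl hc0.le hy)
  have hbound : ∀ y ∈ cpcyl (0 : Sp n × ℝ) (1 / 2), ‖prolong v' y‖ ≤ 2 := by
    intro y hy
    have hy' := parScale_mem_cpcyl (z := z) hc0.le hy
    refine max_le ((hv1 _ hy').trans one_le_two) ?_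
    change ‖spD v' y‖ ≤ 2
    rw [hspD y (hsub' hy), norm_smul, Real.norm_eq_abs, abs_of_pos hc0, hc,
      inv_mul_le_iff₀ hL, mul_comm]
    exact hvD _ hy'
  set η : ℝ := 1 / (8 + 2 * C) with hη
  have hη0 : 0 < η := by positivity
  have hη8 : η ≤ 1 / 8 := one_div_le_one_div_of_le (by norm_num) (by linarith)
  have hCη : C * η ≤ 1 / 2 := by
    rw [hη, mul_one_div, div_le_iff₀ (by positivity)]; linarith
  have hwη := cpcyl_subset_cpcyl 0 hη0.le (show η ≤ 1 / 2 / 2 / 2 by linarith) hw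
  have key := hest U' v' 0 hUo hv's hsol' hsub' hbound w hwη
  have hwn : ‖w - 0‖ ≤ η := by
    obtain ⟨h1, h2, h3⟩ := mem_cpcyl.1 hw
    refine max_le h1 ?_
    simp only [Prod.snd_zero, zero_sub] at h2 h3
    simp only [sub_zero, Real.norm_eq_abs]
    rw [abs_le]
    constructor <;> nlinarith
  have h0U : (0 : Sp n × ℝ) ∈ U' := hsub' (self_mem_cpcyl 0 (by norm_num))
  have hwU : w ∈ U' := hsub' (cpcyl_subset_cpcyl 0 hη0.le (by linarith) hw)
  have h1 : ‖spD v' w - spD v' 0‖ ≤ 1 / 2 := by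
    refine (norm_snd_le (prolong v' w - prolong v' 0)).trans (key.trans ?_)
    exact (mul_le_mul_of_nonneg_left hwn hC).trans hCη
  have hp0 : parScale z c 0 = z := by simp [parScale]
  rw [hspD w hwU, hspD 0 h0U, hp0, ← smul_sub, norm_smul, Real.norm_eq_abs, abs_of_pos hc0, hc,
    inv_mul_le_iff₀ hL] at h1
  have h2 := norm_sub_norm_le (spD v z) (spD v (parScale z c w))
  rw [norm_sub_rev] at h2
  rw [hvz] at h2
  linarith

end HarmonicMap

/-! ### The gradient estimate under small scaled energy -/

section SmallEnergy

variable {n k : ℕ}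

lemma norm_le_one_of_sum_sq_eq_one {y : Fin k → ℝ} (h : ∑ i, y i ^ 2 = 1) : ‖y‖ ≤ 1 := by
  refine (pi_norm_le_iff_of_nonneg zero_le_one).2 fun i => ?_
  rw [Real.norm_eq_abs, ← sq_le_one_iff_abs_le_one, ← h]
  exact Finset.single_le_sum (f := fun i => y i ^ 2) (fun j _ => sq_nonneg _) (Finset.mem_univ i)

lemma measurableSet_pcyl (z : Sp n × ℝ) (r : ℝ) : MeasurableSet (pcyl z r) :=
  isClosed_closedBall.measurableSet.prod measurableSet_Ioc

lemma pcyl_subset_cpcyl (z : Sp n × ℝ) (r : ℝ) : pcyl z r ⊆ cpcyl z r :=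
  Set.prod_mono Subset.rfl Ioc_subset_Icc_self

lemma volume_real_pcyl (z : Sp n × ℝ) {r : ℝ} (hr : 0 < r) :
    volume.real (pcyl z r) = r ^ (n + 2) * volume.real (ball (0 : Sp n) 1) := by
  rw [pcyl, Measure.volume_eq_prod, measureReal_prod_prod,
    Measure.addHaar_real_closedBall _ _ hr.le]
  simp only [Real.volume_real_Ioc, finrank_euclideanSpace, Fintype.card_fin]
  rw [max_eq_left (by nlinarith)]
  ring

lemma volume_pcyl_ne_top (z : Sp n × ℝ) (r : ℝ) : volume (pcyl z r) ≠ ⊤ :=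
  (measure_mono (pcyl_subset_cpcyl z r)).trans_lt (isCompact_cpcyl z r).measure_lt_top |>.ne

lemma continuousOn_gradSq {u : Sp n × ℝ → Fin k → ℝ} {U : Set (Sp n × ℝ)} (hU : IsOpen U)
    (hu : ContDiffOn ℝ ∞ u U) : ContinuousOn (gradSq u) U := by
  have h : ContinuousOn (fun z => ∑ α : Fin n, ∑ i : Fin k,
      (fderiv ℝ u z (sdir n α) i) ^ 2) U :=
    continuousOn_finsetSum _ fun α _ => continuousOn_finsetSum _ fun i _ =>
      ((continuous_apply i).comp_continuousOn (contDiffOn_fderiv_apply hU hu _).continuousOn).pow 2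
  refine h.congr fun z hz => ?_
  simp only [gradSq, pd_eq (hu.differentiableAt_of_isOpen hU hz)]

lemma continuousOn_dtSq {u : Sp n × ℝ → Fin k → ℝ} {U : Set (Sp n × ℝ)} (hU : IsOpen U)
    (hu : ContDiffOn ℝ ∞ u U) : ContinuousOn (dtSq u) U := by
  have h : ContinuousOn (fun z => ∑ i : Fin k, (fderiv ℝ u z (tdir n) i) ^ 2) U :=
    continuousOn_finsetSum _ fun i _ =>
      ((continuous_apply i).comp_continuousOn (contDiffOn_fderiv_apply hU hu _).continuousOn).pow 2
  refine h.congr fun z hz => ?_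
  simp only [dtSq, pd_eq (hu.differentiableAt_of_isOpen hU hz)]

lemma dtSq_nonneg (u : Sp n × ℝ → Fin k → ℝ) (z : Sp n × ℝ) : 0 ≤ dtSq u z :=
  Finset.sum_nonneg fun _ _ => sq_nonneg _

/-- A lower bound on the gradient in a cylinder bounds the scaled energy from below. -/
lemma le_scaled_energy {u : Sp n × ℝ → Fin k → ℝ} {U : Set (Sp n × ℝ)} (hU : IsOpen U)
    (hu : ContDiffOn ℝ ∞ u U) {z : Sp n × ℝ} {r p b : ℝ} (hr : 0 < r) (hp : 0 < p) (hb : 0 ≤ b)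
    (hsub : cpcyl z r ⊆ U) (hlow : ∀ y ∈ cpcyl z r, b ≤ ‖spD u y‖) :
    volume.real (ball (0 : Sp n) 1) * (r * b) ^ p ≤ r ^ (p - (n + 2)) *
      ∫ w in pcyl z r, ((gradSq u w) ^ (p / 2) + r ^ p * (dtSq u w) ^ (p / 2)) := by
  have hinteg : IntegrableOn (fun w => (gradSq u w) ^ (p / 2) + r ^ p * (dtSq u w) ^ (p / 2))
      (pcyl z r) := by
    refine IntegrableOn.mono_set (ContinuousOn.integrableOn_compact (isCompact_cpcyl z r) ?_)
      (pcyl_subset_cpcyl z r)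
    have hp2 : 0 ≤ p / 2 := by positivity
    exact (((continuousOn_gradSq hU hu).mono hsub).rpow_const fun _ _ => Or.inr hp2).add
      (continuousOn_const.mul (((continuousOn_dtSq hU hu).mono hsub).rpow_const
        fun _ _ => Or.inr hp2))
  have hpt : ∀ w ∈ pcyl z r, b ^ p ≤ (gradSq u w) ^ (p / 2) + r ^ p * (dtSq u w) ^ (p / 2) := by
    intro w hw
    have hw' := pcyl_subset_cpcyl z r hw
    have h1 : b ^ 2 ≤ gradSq u w := (pow_le_pow_left₀ hb (hlow w hw') 2).trans
      (norm_spD_sq_le_gradSq (hu.differentiableAt_of_isOpen hU (hsub hw')))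
    have h2 : b ^ p = (b ^ 2) ^ (p / 2) := by
      rw [← Real.rpow_natCast, ← Real.rpow_mul hb]
      congr 1
      push_cast
      ring
    rw [h2]
    have h3 := Real.rpow_le_rpow (sq_nonneg b) h1 (show 0 ≤ p / 2 by positivity)
    have h4 := Real.rpow_nonneg (dtSq_nonneg u w) (p / 2)
    have h5 := Real.rpow_nonneg hr.le p
    nlinarith
  have key := setIntegral_ge_of_const_le_real (measurableSet_pcyl z r) (volume_pcyl_ne_top z r)
    hpt hinteg
  have key' := mul_le_mul_of_nonneg_left key (Real.rpow_nonneg hr.le (p - (n + 2)))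
  refine le_trans (le_of_eq ?_) key'
  rw [volume_real_pcyl z hr, Real.mul_rpow hr.le hb]
  have h6 : r ^ p = r ^ (p - (n + 2)) * r ^ (n + 2) := by
    rw [← Real.rpow_natCast r (n + 2), ← Real.rpow_add hr]
    congr 1
    push_cast
    ring
  rw [h6]
  ring

/-- Small scaled energy yields an interior gradient bound for smooth solutions. -/
theorem exists_norm_spD_le_one (n k : ℕ) {p : ℝ} (hp : 0 < p) :
    ∃ ε : ℝ, 0 < ε ∧ ∀ (U : Set (Sp n × ℝ)) (u : Sp n × ℝ → Fin k → ℝ) (z₀ : Sp n × ℝ),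
      IsOpen U → ContDiffOn ℝ ∞ u U → SphereValued u U → HeatFlow u U → cpcyl z₀ 1 ⊆ U →
      (∀ z ∈ cpcyl z₀ 1, ∀ r : ℝ, 0 < r → r ≤ 2 → r ^ (p - (n + 2)) *
        ∫ w in pcyl z r, ((gradSq u w) ^ (p / 2) + r ^ p * (dtSq u w) ^ (p / 2)) ≤ ε ^ p) →
      ‖spD u z₀‖ ≤ 1 := by
  obtain ⟨η, hη, hη8, hhalf⟩ := exists_half_le_norm_spD n k
  set κ := volume.real (ball (0 : Sp n) 1) with hκ
  have hκ0 : 0 < κ := ENNReal.toReal_pos (measure_ball_pos _ _ one_pos).ne' measure_ball_lt_top.ne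
  refine ⟨(κ / 2) ^ (1 / p) * (η / 2), by positivity, ?_⟩
  intro U u z₀ hU hu hsph hflow hsub hsmall
  by_contra! hgt
  obtain ⟨z, ρ, hρ, hρ1, hzsub, hzL, hzle⟩ := exists_point_picking (f := fun z => ‖spD u z‖)
    one_pos ((hu.spD hU).continuousOn.norm.mono hsub) (zero_lt_one.trans hgt)
  set L := ‖spD u z‖ with hL
  have hρL : 1 < ρ * L := by linarith
  have hL0 : 0 < L := by
    by_contra! h
    nlinarith
  have hLρ : L⁻¹ < ρ := by rw [inv_lt_iff_one_lt_mul₀ hL0]; linarith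
  have hLi : 0 < L⁻¹ := inv_pos.2 hL0
  have hsub2 : cpcyl z (L⁻¹ * (1 / 2)) ⊆ cpcyl z (ρ / 2) :=
    cpcyl_subset_cpcyl z (by positivity) (by linarith)
  have hsub3 : cpcyl z (L⁻¹ * (1 / 2)) ⊆ U :=
    (cpcyl_subset_cpcyl z (by positivity) (by linarith)).trans (hzsub.trans hsub)
  have hlow := hhalf U u z L hL0 hU hu (hflow.isSemilinearSol hU hu) hsub3
    (fun y hy => norm_le_one_of_sum_sq_eq_one (hsph y (hsub3 hy)))
    (fun y hy => hzle y (hsub2 hy)) rfl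
  have hr0 : 0 < L⁻¹ * η := by positivity
  have hrle : L⁻¹ * η ≤ L⁻¹ * (1 / 2) := by gcongr; linarith
  have hE := le_scaled_energy hU hu hr0 hp (by positivity : 0 ≤ L / 2)
    ((cpcyl_subset_cpcyl z hr0.le hrle).trans hsub3) hlow
  have hS := hsmall z (hzsub (self_mem_cpcyl z hρ.le)) (L⁻¹ * η) hr0 (by linarith)
  have h1 : L⁻¹ * η * (L / 2) = η / 2 := by field_simp
  have h2 : ((κ / 2) ^ (1 / p) * (η / 2)) ^ p = κ / 2 * (η / 2) ^ p := by
    rw [Real.mul_rpow (by positivity) (by positivity), ← Real.rpow_mul (by positivity),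
      one_div_mul_cancel hp.ne', Real.rpow_one]
  rw [h1] at hE
  rw [h2] at hS
  have h3 : 0 < (η / 2) ^ p := by positivity
  nlinarith

end SmallEnergy

/-! ### Continuity in time of the spatial derivatives -/

section TimeSlices

variable {n : ℕ} {E : Type*} [NormedAddCommGroup E] [NormedSpace ℝ E]

lemma uniqueDiffOn_closedBall_prod_Ioc {R a : ℝ} (hR : 0 < R) :
    UniqueDiffOn ℝ (closedBall (0 : Sp n) R ×ˢ Ioc (-a) 0) :=
  (uniqueDiffOn_convex (convex_closedBall 0 R)
    ⟨0, ball_subset_interior_closedBall (mem_ball_self hR)⟩).prod (uniqueDiffOn_Ioc _ _)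

open scoped Pointwise in
lemma iteratedFDeriv_slice_eq {u : Sp n × ℝ → E} {R a : ℝ}
    (hu : ContDiffOn ℝ ∞ u (closedBall 0 R ×ˢ Ioc (-a) 0)) (m : ℕ) {x : Sp n} (hx : ‖x‖ < R)
    {t : ℝ} (ht : t ∈ Ioc (-a) 0) :
    iteratedFDeriv ℝ m (fun y => u (y, t)) x =
      (iteratedFDerivWithin ℝ m u (closedBall 0 R ×ˢ Ioc (-a) 0) (x, t)).compContinuousLinearMap
        fun _ => ContinuousLinearMap.inl ℝ (Sp n) ℝ := by
  have hR : 0 < R := (norm_nonneg x).trans_lt hx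
  have ha : 0 < a := by linarith [ht.1, ht.2]
  set D := closedBall (0 : Sp n) R ×ˢ Ioc (-a) 0 with hD
  set e : Sp n × ℝ := (0, t) with he
  have hDu : UniqueDiffOn ℝ D := uniqueDiffOn_closedBall_prod_Ioc hR
  have hBu : UniqueDiffOn ℝ (closedBall (0 : Sp n) R) := uniqueDiffOn_convex
    (convex_closedBall 0 R) ⟨0, ball_subset_interior_closedBall (mem_ball_self hR)⟩
  have hxB : closedBall (0 : Sp n) R ∈ 𝓝 x :=
    Filter.mem_of_superset (isOpen_ball.mem_nhds (by simpa using hx)) ball_subset_closedBall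
  set D' : Set (Sp n × ℝ) := -e +ᵥ D with hD'
  have hmem : ∀ z, z ∈ D' ↔ e + z ∈ D := fun z => by
    rw [hD', Set.mem_vadd_set_iff_neg_vadd_mem, neg_neg, vadd_eq_add]
  have hvadd : e +ᵥ D' = D := by rw [hD', vadd_vadd, add_neg_cancel, zero_vadd]
  have hD'u : UniqueDiffOn ℝ D' := by
    have hconv : Convex ℝ D := (convex_closedBall _ _).prod (convex_Ioc _ _)
    refine uniqueDiffOn_convex (hconv.vadd _) ?_
    have hne : (interior D).Nonempty := by
      refine ⟨(0, -a / 2), ?_⟩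
      rw [hD, interior_prod_eq]
      exact ⟨ball_subset_interior_closedBall (mem_ball_self hR),
        by rw [interior_Ioc]; constructor <;> linarith⟩
    rw [hD', interior_vadd]
    exact hne.vadd_set
  set g : Sp n × ℝ → E := fun z => u (e + z) with hg
  have hgs : ContDiffOn ℝ ∞ g D' :=
    hu.comp (contDiff_const.add contDiff_id).contDiffOn fun z hz => (hmem z).1 hz
  have hpre : ContinuousLinearMap.inl ℝ (Sp n) ℝ ⁻¹' D' = closedBall 0 R := by
    ext y
    simp [hmem, hD, he, ht.1, ht.2]
  have hslice : (fun y => u (y, t)) = g ∘ ContinuousLinearMap.inl ℝ (Sp n) ℝ := by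
    ext y
    simp [hg, he]
  have hsmooth : ContDiffOn ℝ ∞ (fun y => u (y, t)) (closedBall 0 R) :=
    hu.comp (contDiff_id.prodMk contDiff_const).contDiffOn fun y hy => ⟨hy, ht⟩
  have hmle : (m : ℕ∞ω) ≤ ∞ := by exact_mod_cast le_top
  rw [← iteratedFDerivWithin_eq_iteratedFDeriv hBu
    ((hsmooth.contDiffAt hxB).of_le hmle) (mem_of_mem_nhds hxB), hslice, ← hpre,
    ContinuousLinearMap.iteratedFDerivWithin_comp_right _ hgs hD'u (by rwa [hpre])
      ((hmem _).2 ?_) hmle, hg, iteratedFDerivWithin_comp_add_left, hvadd]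
  · simp [he]
  · simpa [hD, he, ht.1, ht.2] using hx.le

lemma continuousOn_iteratedFDeriv_slice {u : Sp n × ℝ → E} {R a : ℝ}
    (hu : ContDiffOn ℝ ∞ u (closedBall 0 R ×ˢ Ioc (-a) 0)) (m : ℕ) {x : Sp n} (hx : ‖x‖ < R) :
    ContinuousOn (fun t => iteratedFDeriv ℝ m (fun y => u (y, t)) x) (Ioc (-a) 0) := by
  have hR : 0 < R := (norm_nonneg x).trans_lt hx
  have h1 : ContinuousOn (iteratedFDerivWithin ℝ m u (closedBall 0 R ×ˢ Ioc (-a) 0))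
      (closedBall 0 R ×ˢ Ioc (-a) 0) :=
    hu.continuousOn_iteratedFDerivWithin (by exact_mod_cast le_top)
      (uniqueDiffOn_closedBall_prod_Ioc hR)
  have h2 : ContinuousOn
      (fun t => iteratedFDerivWithin ℝ m u (closedBall 0 R ×ˢ Ioc (-a) 0) (x, t)) (Ioc (-a) 0) :=
    h1.comp (by fun_prop) fun t ht => ⟨by simpa using hx.le, ht⟩
  refine (ContinuousLinearMap.continuous (ContinuousMultilinearMap.compContinuousLinearMapL
    (F := E) fun _ : Fin m => ContinuousLinearMap.inl ℝ (Sp n) ℝ)).comp_continuousOn h2 |>.congr ?_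
  intro t ht
  exact iteratedFDeriv_slice_eq hu m hx ht

end TimeSlices

/-- Lemma 2.3 of the paper (case N = S^{k-1}): smallness of the scaled Morrey quantity on
`P₂` implies interior bounds on all derivatives on `P_{1/2}`. -/
theorem small_energy_regularity_heat_flow_sphere
    (n k : ℕ) (hn : 2 ≤ n) (hk : 2 ≤ k) (p : ℝ) (hp1 : 1 < p) (hp2 : p ≤ 2) :
    ∃ ε : ℝ, 0 < ε ∧
      ∀ m : ℕ, 1 ≤ m →
      ∃ C : ℝ, 0 < C ∧
        ∀ u : Sp n × ℝ → Fin k → ℝ,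
          ContDiffOn ℝ (⊤ : ℕ∞) u (pcyl ((0 : Sp n), (0 : ℝ)) 4) →
          SphereValued u (pcyl ((0 : Sp n), (0 : ℝ)) 4) →
          HeatFlow u (pcyl ((0 : Sp n), (0 : ℝ)) 4) →
          (∀ z ∈ pcyl ((0 : Sp n), (0 : ℝ)) 2, ∀ r : ℝ, 0 < r → r ≤ 2 →
            r ^ (p - (n + 2)) *
                ∫ w in pcyl z r, ((gradSq u w) ^ (p / 2) + r ^ p * (dtSq u w) ^ (p / 2))
              ≤ ε ^ p) →
          ∀ z ∈ pcyl ((0 : Sp n), (0 : ℝ)) (1 / 2),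
            ‖iteratedFDeriv ℝ m (fun x => u (x, z.2)) z.1‖ ≤ C := by
  obtain ⟨ε, hε, hgrad⟩ := exists_norm_spD_le_one n k (zero_lt_one.trans hp1)
  refine ⟨ε, hε, fun m _ => ?_⟩
  obtain ⟨C, hC, hbound⟩ := exists_norm_iteratedFDeriv_le (n := n) m (Fin k → ℝ)
    (sphereNonlin n k) contDiff_sphereNonlin 1 (1 / 2) one_pos (by norm_num)
  refine ⟨C, hC, fun u hu hsph hflow hsmall => ?_⟩
  set U : Set (Sp n × ℝ) := ball 0 4 ×ˢ Ioo (-16) 0 with hUdef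
  have hU : IsOpen U := isOpen_ball.prod isOpen_Ioo
  have hsub : U ⊆ pcyl ((0 : Sp n), (0 : ℝ)) 4 := by
    refine Set.prod_mono ball_subset_closedBall ?_
    norm_num [Ioo_subset_Ioc_self]
  have hmemU : ∀ y : Sp n × ℝ, ‖y.1‖ ≤ 2 → -2 ≤ y.2 → y.2 < 0 → y ∈ U := fun y h1 h2 h3 =>
    ⟨mem_ball_zero_iff.2 (by linarith), by linarith, h3⟩
  have huU := hu.mono hsub
  have hflowU : HeatFlow u U := fun z hz => hflow z (hsub hz)
  have hsphU : SphereValued u U := fun z hz => hsph z (hsub hz)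
  have hspD : ∀ z : Sp n × ℝ, ‖z.1‖ ≤ 1 → -1 ≤ z.2 → z.2 < 0 → ‖spD u z‖ ≤ 1 := by
    intro z h1 h2 h3
    have hz : ∀ y ∈ cpcyl z 1, ‖y.1‖ ≤ 2 ∧ -2 ≤ y.2 ∧ y.2 < 0 := by
      intro y hy
      obtain ⟨h4, h5, h6⟩ := mem_cpcyl.1 hy
      have h7 := norm_le_norm_add_norm_sub' y.1 z.1
      exact ⟨by linarith, by linarith, by linarith⟩
    refine hgrad U u z hU huU hsphU hflowU
      (fun y hy => hmemU y (hz y hy).1 (hz y hy).2.1 (hz y hy).2.2) fun y hy => hsmall y ?_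
    obtain ⟨h4, h5, h6⟩ := hz y hy
    refine ⟨mem_closedBall_zero_iff.2 h4, ?_, h6.le⟩
    norm_num
    linarith
  have hneg : ∀ z : Sp n × ℝ, ‖z.1‖ ≤ 1 / 2 → -(1 / 4) ≤ z.2 → z.2 < 0 →
      ‖iteratedFDeriv ℝ m (fun x => u (x, z.2)) z.1‖ ≤ C := by
    intro z h1 h2 h3
    have hz : ∀ y ∈ cpcyl z (1 / 2), ‖y.1‖ ≤ 1 ∧ -1 ≤ y.2 ∧ y.2 < 0 := by
      intro y hy
      obtain ⟨h4, h5, h6⟩ := mem_cpcyl.1 hy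
      have h7 := norm_le_norm_add_norm_sub' y.1 z.1
      exact ⟨by linarith, by linarith, by linarith⟩
    have hzU : cpcyl z (1 / 2) ⊆ U := fun y hy =>
      hmemU y (by linarith [(hz y hy).1]) (by linarith [(hz y hy).2.1]) (hz y hy).2.2
    exact hbound U u z hU huU (hflowU.isSemilinearSol hU huU) hzU fun y hy =>
      max_le (norm_le_one_of_sum_sq_eq_one (hsphU y (hzU hy)))
        (hspD y (hz y hy).1 (hz y hy).2.1 (hz y hy).2.2)
  rintro ⟨x, t⟩ ⟨hx, ht⟩
  simp only [mem_closedBall_zero_iff, zero_sub] at hx ht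
  obtain ⟨ht1, ht2⟩ := ht
  norm_num at ht1
  rcases ht2.lt_or_eq with ht0 | rfl
  · exact hneg (x, t) hx (by linarith) ht0
  have hu' : ContDiffOn ℝ ∞ u (closedBall 0 4 ×ˢ Ioc (-16) 0) := by
    convert hu using 1
    norm_num [pcyl]
  have hIoc : ContinuousWithinAt (fun t => iteratedFDeriv ℝ m (fun y => u (y, t)) x)
      (Ioc (-16) 0) 0 :=
    continuousOn_iteratedFDeriv_slice hu' m (hx.trans_lt (by norm_num)) 0 ⟨by norm_num, le_rfl⟩
  have hcont := hIoc.mono_of_mem_nhdsWithin (Filter.mem_of_superset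
    (Ioo_mem_nhdsLT (show (-16 : ℝ) < 0 by norm_num)) Ioo_subset_Ioc_self)
  refine le_of_tendsto hcont.norm ?_
  filter_upwards [Ioo_mem_nhdsLT (show (-(1 / 4) : ℝ) < 0 by norm_num)] with s hs
  exact hneg (x, s) hx hs.1.le hs.2
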